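/- arXiv:math/0610862 — 2 statements merged into one kernel-verified Lean document; each statement's English description precedes it below -/
import Mathlib

section
/- (Vershik–Kerov, Logan–Shepp) The constant in the Ulam problem equals 2: if ℓ_n is the length of the longest increasing subsequence of a uniformly random permutation of {1,…,n}, then ℓ_n / √n → 2 in probability as n → ∞. -/
open Filter
open scoped Classical

/-- The length of the longest increasing subsequence of a permutation `π` of
`{0, …, n-1}`: the largest `k` for which there are indices `i₁ < ⋯ < i_k` with
`π i₁ < ⋯ < π i_k`. -/
noncomputable def lisLength {n : ℕ} (π : Equiv.Perm (Fin n)) : ℕ :=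
  Finset.sup
    (Finset.univ.filter fun s : Finset (Fin n) =>
      ∀ i ∈ s, ∀ j ∈ s, i < j → π i < π j)
    Finset.card

instance (n : ℕ) : MeasurableSpace (Equiv.Perm (Fin n)) := ⊤

/-- The uniform probability measure on the symmetric group of `{0, …, n-1}`. -/
noncomputable def uniformPerm (n : ℕ) : MeasureTheory.Measure (Equiv.Perm (Fin n)) :=
  (PMF.uniformOfFintype (Equiv.Perm (Fin n))).toMeasure

namespace Ulam

/-- Expectation of a function of a random subset of `A` that contains each element
independently with probability `a`. -/
noncomputable def E {α : Type*} (a : ℝ) (A : Finset α) (f : Finset α → ℝ) : ℝ :=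
  ∑ s ∈ A.powerset, a ^ s.card * (1 - a) ^ (A.card - s.card) * f s

/-- Expectation of a function of a Bernoulli variable. -/
noncomputable def EB (a : ℝ) (f : Bool → ℝ) : ℝ := a * f true + (1 - a) * f false

/-- Adjoin `i` to `s` when the bit `b` is set. -/
def addb {α : Type*} [DecidableEq α] (b : Bool) (i : α) (s : Finset α) : Finset α :=
  if b then insert i s else s

section basic
variable {α β : Type*}

lemma E_congr {a : ℝ} {A : Finset α} {f g : Finset α → ℝ} (h : ∀ s, s ⊆ A → f s = g s) :
    E a A f = E a A g := by
  unfold E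
  refine Finset.sum_congr rfl fun s hs => ?_
  rw [h s (Finset.mem_powerset.mp hs)]

lemma E_mono {a : ℝ} (h0 : 0 ≤ a) (h1 : a ≤ 1) {A : Finset α} {f g : Finset α → ℝ}
    (h : ∀ s, s ⊆ A → f s ≤ g s) : E a A f ≤ E a A g := by
  unfold E
  refine Finset.sum_le_sum fun s hs => ?_
  have h1' : 0 ≤ 1 - a := by linarith
  exact mul_le_mul_of_nonneg_left (h s (Finset.mem_powerset.mp hs)) (by positivity)

lemma E_add (a : ℝ) (A : Finset α) (f g : Finset α → ℝ) :
    E a A (fun s => f s + g s) = E a A f + E a A g := by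
  simp only [E, mul_add, Finset.sum_add_distrib]

lemma E_mul (a c : ℝ) (A : Finset α) (f : Finset α → ℝ) :
    E a A (fun s => c * f s) = c * E a A f := by
  simp only [E, Finset.mul_sum]
  refine Finset.sum_congr rfl fun s hs => by ring

lemma E_exp (a c : ℝ) (A : Finset α) :
    E a A (fun s => c ^ s.card) = (a * c + (1 - a)) ^ A.card := by
  rw [← Finset.sum_pow_mul_eq_add_pow]
  unfold E
  refine Finset.sum_congr rfl fun s hs => by rw [mul_pow]; ring

lemma E_const (a c : ℝ) (A : Finset α) : E a A (fun _ => c) = c := by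
  have h := E_exp a 1 A
  simp only [one_pow, mul_one] at h
  have := E_mul a c A (fun _ => 1)
  simp only [mul_one] at this
  rw [this, h]; simp

lemma E_comm (a b : ℝ) (A : Finset α) (B : Finset β) (f : Finset α → Finset β → ℝ) :
    E a A (fun s => E b B (fun t => f s t)) = E b B (fun t => E a A (fun s => f s t)) := by
  simp only [E, Finset.mul_sum]
  rw [Finset.sum_comm]
  refine Finset.sum_congr rfl fun s _ => Finset.sum_congr rfl fun t _ => by ring

lemma E_EB_comm (a b : ℝ) (A : Finset α) (f : Finset α → Bool → ℝ) :
    E a A (fun s => EB b (fun t => f s t)) = EB b (fun t => E a A (fun s => f s t)) := by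
  simp only [EB, E_add, E_mul]

lemma E_insert [DecidableEq α] (a : ℝ) (A : Finset α) (i : α) (hi : i ∉ A)
    (f : Finset α → ℝ) :
    E a (insert i A) f = E a A (fun s => EB a (fun b => f (addb b i s))) := by
  unfold E
  rw [Finset.sum_powerset_insert hi, ← Finset.sum_add_distrib]
  refine Finset.sum_congr rfl fun s hs => ?_
  have hs' := Finset.mem_powerset.mp hs
  have hc := Finset.card_le_card hs'
  have his : i ∉ s := fun h => hi (hs' h)
  rw [Finset.card_insert_of_notMem hi, Finset.card_insert_of_notMem his]
  have e1 : A.card + 1 - s.card = (A.card - s.card) + 1 := by omega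
  have e2 : A.card + 1 - (s.card + 1) = A.card - s.card := by omega
  rw [e1, e2]
  simp only [EB, addb, if_true, Bool.false_eq_true, if_false]
  ring

lemma E_empty (a : ℝ) (f : Finset α → ℝ) : E a ∅ f = f ∅ := by
  simp [E]

lemma E_union [DecidableEq α] (a : ℝ) (A B : Finset α) (h : Disjoint A B)
    (f : Finset α → ℝ) :
    E a (A ∪ B) f = E a A (fun s => E a B (fun t => f (s ∪ t))) := by
  induction B using Finset.induction_on generalizing f with
  | empty => simp [E_empty]
  | insert i B hi ih =>
    rw [Finset.disjoint_insert_right] at h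
    have : A ∪ insert i B = insert i (A ∪ B) := by simp
    rw [this, E_insert _ _ _ (by simp [hi, h.1]), ih h.2]
    refine E_congr fun s _ => ?_
    rw [E_insert _ _ _ hi]
    refine E_congr fun t _ => ?_
    simp [EB, addb]

lemma E_image [DecidableEq α] [DecidableEq β] (a : ℝ) (A : Finset α) (e : α → β)
    (he : Function.Injective e) (f : Finset β → ℝ) :
    E a (A.image e) f = E a A (fun s => f (s.image e)) := by
  induction A using Finset.induction_on generalizing f with
  | empty => simp [E_empty]
  | insert i A hi ih =>
    rw [Finset.image_insert, E_insert _ _ _ (by simpa [he.eq_iff] using hi), ih,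
      E_insert _ _ _ hi]
    refine E_congr fun s _ => ?_
    simp [EB, addb, Finset.image_insert]

/-- The union of two independent random sets. -/
lemma E_or [DecidableEq α] (a r : ℝ) (A : Finset α) (f : Finset α → ℝ) :
    E a A (fun s => E r A (fun t => f (s ∪ t))) = E (1 - (1 - a) * (1 - r)) A f := by
  induction A using Finset.induction_on generalizing f with
  | empty => simp [E_empty]
  | insert i A hi ih =>
    rw [E_insert _ _ _ hi, E_insert _ _ _ hi, ← ih]
    refine E_congr fun s _ => ?_
    simp only [E_insert _ _ _ hi]
    rw [← E_EB_comm]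
    refine E_congr fun t _ => ?_
    simp [EB, addb]
    ring

lemma E_inter_range (a : ℝ) {z N : ℕ} (h : z ≤ N) (f : Finset ℕ → ℝ) :
    E a (Finset.range N) (fun s => f (s.filter (· < z))) = E a (Finset.range z) f := by
  have : Finset.range N = Finset.range z ∪ Finset.Ico z N := by
    ext; simp; omega
  rw [this, E_union _ _ _ (by
    rw [Finset.disjoint_left]; intro i; simp; omega)]
  refine E_congr fun s hs => ?_
  rw [E_congr (g := fun _ => f s), E_const]
  intro t ht
  congr 1
  ext i
  simp only [Finset.mem_filter, Finset.mem_union]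
  constructor
  · rintro ⟨h1 | h1, h2⟩
    · exact h1
    · have := ht h1; simp at this; omega
  · intro h1
    have := hs h1
    simp at this
    exact ⟨Or.inl h1, this⟩

end basic

/-! ### Discrete Burke property -/

/-- Vertical increments along a row. -/
def jbit (x w : Finset ℕ) (J : Bool) : ℕ → Bool
  | 0 => J
  | i + 1 => !(decide (i ∈ x)) && (jbit x w J i || decide (i ∈ w))

/-- Horizontal increments of the next row. -/
def rowOut (M : ℕ) (x w : Finset ℕ) (J : Bool) : Finset ℕ :=
  (Finset.range M).filter (fun i =>
    (!(jbit x w J i) && (decide (i ∈ x) || decide (i ∈ w))) = true)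

lemma jbit_congr {x x' w w' : Finset ℕ} {J : Bool} {M : ℕ}
    (hx : ∀ i < M, i ∈ x ↔ i ∈ x') (hw : ∀ i < M, i ∈ w ↔ i ∈ w') :
    ∀ i ≤ M, jbit x w J i = jbit x' w' J i := by
  intro i
  induction i with
  | zero => intro _; rfl
  | succ i ih =>
    intro hi
    simp only [jbit]
    rw [ih (by omega)]
    simp only [hx i (by omega), hw i (by omega)]

lemma mem_addb_of_lt {b : Bool} {M i : ℕ} (h : i < M) (s : Finset ℕ) :
    i ∈ addb b M s ↔ i ∈ s := by
  unfold addb; split_ifs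
  · simp; omega
  · rfl

lemma mem_addb_self {b : Bool} {M : ℕ} {s : Finset ℕ} (hs : s ⊆ Finset.range M) :
    M ∈ addb b M s ↔ b = true := by
  have : M ∉ s := fun h => by simpa using hs h
  unfold addb; split_ifs with h <;> simp_all

lemma jbit_addb {M : ℕ} {x w : Finset ℕ} (hx : x ⊆ Finset.range M) (hw : w ⊆ Finset.range M)
    (bx bw J : Bool) : jbit (addb bx M x) (addb bw M w) J (M + 1)
      = (!bx && (jbit x w J M || bw)) := by
  simp only [jbit]
  rw [jbit_congr (M := M) (x' := x) (w' := w) (fun i hi => mem_addb_of_lt hi _)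
    (fun i hi => mem_addb_of_lt hi _) M le_rfl]
  simp only [mem_addb_self hx, mem_addb_self hw, Bool.decide_eq_true]

lemma rowOut_addb {M : ℕ} {x w : Finset ℕ} (hx : x ⊆ Finset.range M) (hw : w ⊆ Finset.range M)
    (bx bw J : Bool) : rowOut (M + 1) (addb bx M x) (addb bw M w) J
      = addb (!(jbit x w J M) && (bx || bw)) M (rowOut M x w J) := by
  have key := jbit_congr (J := J) (M := M) (x := addb bx M x) (w := addb bw M w) (x' := x)
    (w' := w) (fun i hi => mem_addb_of_lt hi _) (fun i hi => mem_addb_of_lt hi _)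
  have hsub : rowOut M x w J ⊆ Finset.range M := Finset.filter_subset _ _
  ext i
  rcases lt_trichotomy i M with h | h | h
  · rw [mem_addb_of_lt h]
    simp only [rowOut, Finset.mem_filter, Finset.mem_range, key i h.le, mem_addb_of_lt h]
    simp [h, Nat.lt_succ_of_lt h]
  · subst h
    rw [mem_addb_self hsub]
    simp only [rowOut, Finset.mem_filter, Finset.mem_range, key i le_rfl, mem_addb_self hx,
      mem_addb_self hw, Bool.decide_eq_true]
    simp
  · constructor
    · intro h'
      simp only [rowOut, Finset.mem_filter, Finset.mem_range] at h'
      omega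
    · intro h'
      unfold addb at h'
      split_ifs at h'
      · rcases Finset.mem_insert.mp h' with h1 | h1
        · omega
        · have := hsub h1; simp at this; omega
      · have := hsub h'; simp at this; omega

lemma burke_row {a b p : ℝ} (h : a * b = p * (1 - a) * (1 - b)) (M : ℕ)
    (F : Finset ℕ → Bool → ℝ) :
    E a (Finset.range M) (fun x => E p (Finset.range M) (fun w =>
      EB b (fun J => F (rowOut M x w J) (jbit x w J M))))
    = E a (Finset.range M) (fun x => EB b (fun J => F x J)) := by
  induction M generalizing F with
  | zero => simp [E_empty, rowOut, jbit]
  | succ M ih =>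
    have hM : M ∉ Finset.range M := by simp
    simp only [Finset.range_add_one, E_insert _ _ _ hM]
    have step : E a (Finset.range M) (fun x => E p (Finset.range M) (fun w =>
        EB b (fun J => (fun (X : Finset ℕ) (K : Bool) => EB a (fun bx => EB p (fun bw =>
          F (addb (!K && (bx || bw)) M X) (!bx && (K || bw)))))
            (rowOut M x w J) (jbit x w J M)))) =
        E a (Finset.range M) (fun s => EB a (fun b_1 => E p (Finset.range M) (fun s_1 =>
          EB p (fun b_2 => EB b (fun J =>
            F (rowOut (M + 1) (addb b_1 M s) (addb b_2 M s_1) J)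
              (jbit (addb b_1 M s) (addb b_2 M s_1) J (M + 1))))))) := by
      refine E_congr fun x hx => ?_
      rw [← E_EB_comm]
      refine E_congr fun w hw => ?_
      simp only [jbit_addb hx hw, rowOut_addb hx hw]
      simp only [EB]
      ring
    rw [← step]
    refine (ih (fun (X : Finset ℕ) (K : Bool) => EB a (fun bx => EB p (fun bw =>
          F (addb (!K && (bx || bw)) M X) (!bx && (K || bw)))))).trans ?_
    refine E_congr fun x hx => ?_
    simp only [EB]
    simp
    linear_combination (F (addb false M x) false - F (addb true M x) true) * h

/-! ### Last passage heights -/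

/-- Last passage heights with boundary values `S` and `T`. -/
def hgt (S T : ℕ → ℕ) (ω : Finset (ℕ × ℕ)) : ℕ → ℕ → ℕ
  | i, 0 => S i
  | 0, j + 1 => T (j + 1)
  | i + 1, j + 1 => max (hgt S T ω i (j + 1)) (max (hgt S T ω (i + 1) j)
      (hgt S T ω i j + if (i, j) ∈ ω then 1 else 0))
  termination_by i j => i + j

lemma hgt_zero_right (S T : ℕ → ℕ) (ω : Finset (ℕ × ℕ)) (i : ℕ) : hgt S T ω i 0 = S i := by
  rw [hgt]

lemma hgt_zero_left (S T : ℕ → ℕ) (ω : Finset (ℕ × ℕ)) (j : ℕ) :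
    hgt S T ω 0 (j + 1) = T (j + 1) := by
  rw [hgt]

lemma hgt_succ (S T : ℕ → ℕ) (ω : Finset (ℕ × ℕ)) (i j : ℕ) :
    hgt S T ω (i + 1) (j + 1) = max (hgt S T ω i (j + 1)) (max (hgt S T ω (i + 1) j)
      (hgt S T ω i j + if (i, j) ∈ ω then 1 else 0)) := by
  rw [hgt]

/-- Being a supersolution of the last passage recursion. -/
structure Super (ω : Finset (ℕ × ℕ)) (f : ℕ → ℕ → ℤ) : Prop where
  left : ∀ i j, f i (j + 1) ≤ f (i + 1) (j + 1)
  down : ∀ i j, f (i + 1) j ≤ f (i + 1) (j + 1)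
  diag : ∀ i j, f i j + (if (i, j) ∈ ω then 1 else 0) ≤ f (i + 1) (j + 1)

lemma super_hgt (S T : ℕ → ℕ) (ω : Finset (ℕ × ℕ)) (c : ℤ) :
    Super ω (fun i j => (hgt S T ω i j : ℤ) + c) := by
  constructor <;> intro i j <;> simp only [hgt_succ] <;> push_cast <;> omega

lemma Super.max {ω : Finset (ℕ × ℕ)} {f g : ℕ → ℕ → ℤ} (hf : Super ω f) (hg : Super ω g) :
    Super ω (fun i j => Max.max (f i j) (g i j)) := by
  constructor <;> intro i j
  · have := hf.left i j; have := hg.left i j; omega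
  · have := hf.down i j; have := hg.down i j; omega
  · have := hf.diag i j; have := hg.diag i j; omega

lemma hgt_le_super {S T : ℕ → ℕ} {ω : Finset (ℕ × ℕ)} {f : ℕ → ℕ → ℤ} (hf : Super ω f)
    (h0 : ∀ i, (S i : ℤ) ≤ f i 0) (h1 : ∀ j, (T (j + 1) : ℤ) ≤ f 0 (j + 1)) :
    ∀ i j, (hgt S T ω i j : ℤ) ≤ f i j := by
  intro i j
  induction j generalizing i with
  | zero => rw [hgt_zero_right]; exact h0 i
  | succ j ih =>
    induction i with
    | zero => rw [hgt_zero_left]; exact h1 j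
    | succ i ih' =>
      rw [hgt_succ]
      have := hf.left i j
      have := hf.down i j
      have := hf.diag i j
      have := ih i
      have := ih (i + 1)
      push_cast
      omega

/-- Number of elements below `i`. -/
def cnt (x : Finset ℕ) (i : ℕ) : ℕ := (x.filter (· < i)).card

lemma cnt_zero (x : Finset ℕ) : cnt x 0 = 0 := by simp [cnt]

lemma cnt_empty (i : ℕ) : cnt ∅ i = 0 := by simp [cnt]

lemma cnt_succ (x : Finset ℕ) (i : ℕ) : cnt x (i + 1) = cnt x i + if i ∈ x then 1 else 0 := by
  unfold cnt
  split_ifs with h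
  · have : x.filter (· < i + 1) = insert i (x.filter (· < i)) := by
      ext k; simp only [Finset.mem_filter, Finset.mem_insert]
      constructor
      · rintro ⟨h1, h2⟩
        by_cases hk : k = i
        · exact Or.inl hk
        · exact Or.inr ⟨h1, by omega⟩
      · rintro (h1 | ⟨h1, h2⟩)
        · subst h1; exact ⟨h, by omega⟩
        · exact ⟨h1, by omega⟩
    rw [this, Finset.card_insert_of_notMem (by simp)]
  · congr 1
    ext k; simp only [Finset.mem_filter]
    constructor
    · rintro ⟨h1, h2⟩
      refine ⟨h1, ?_⟩
      have : k ≠ i := fun h' => h (h' ▸ h1)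
      omega
    · rintro ⟨h1, h2⟩; exact ⟨h1, by omega⟩

lemma cnt_mono (x : Finset ℕ) : Monotone (cnt x) := by
  refine monotone_nat_of_le_succ fun i => ?_
  rw [cnt_succ]; omega

lemma cnt_diff {x x' : Finset ℕ} (h : x ⊆ x') {z i : ℕ} (hi : z ≤ i) :
    (cnt x i : ℤ) - cnt x z ≤ cnt x' i - cnt x' z := by
  induction i, hi using Nat.le_induction with
  | base => simp
  | succ i hi ih =>
    rw [cnt_succ, cnt_succ]
    have := @h i
    split_ifs <;> push_cast <;> first | omega | (exfalso; tauto)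

lemma cnt_full {x : Finset ℕ} {M : ℕ} (h : x ⊆ Finset.range M) : cnt x M = x.card := by
  unfold cnt
  congr 1
  rw [Finset.filter_eq_self]
  intro i hi
  simpa using h hi

/-- Heights with random boundary. -/
def Gam (x y : Finset ℕ) (ω : Finset (ℕ × ℕ)) (i j : ℕ) : ℕ := hgt (cnt x) (cnt y) ω i j

/-- Heights without boundary. -/
def H (ω : Finset (ℕ × ℕ)) (i j : ℕ) : ℕ := Gam ∅ ∅ ω i j

lemma Gam_mono {x x' y y' : Finset ℕ} (hx : x ⊆ x') (hy : y ⊆ y') (ω : Finset (ℕ × ℕ))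
    (i j : ℕ) : Gam x y ω i j ≤ Gam x' y' ω i j := by
  have key := hgt_le_super (S := cnt x) (T := cnt y) (super_hgt (cnt x') (cnt y') ω 0)
    (fun i => by
      rw [hgt_zero_right]
      have := cnt_diff hx (Nat.zero_le i); simp only [cnt_zero] at this; omega)
    (fun j => by
      rw [hgt_zero_left]
      have := cnt_diff hy (Nat.zero_le (j + 1)); simp only [cnt_zero] at this; omega) i j
  unfold Gam; omega

/-- The main deterministic comparison. -/
lemma Gam_compare {x x' y y' : Finset ℕ} (hx : x ⊆ x') (hy : y ⊆ y') (ω : Finset (ℕ × ℕ))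
    (z i j : ℕ) :
    (Gam x y ω i j : ℤ) ≤ max (max ((H ω i j : ℤ) + cnt x z) ((H ω i j : ℤ) + cnt y z))
      (max ((Gam x' ∅ ω i j : ℤ) + (cnt x z - cnt x' z))
        ((Gam ∅ y' ω i j : ℤ) + (cnt y z - cnt y' z))) := by
  refine hgt_le_super (S := cnt x) (T := cnt y)
    (((super_hgt (cnt ∅) (cnt ∅) ω (cnt x z)).max (super_hgt (cnt ∅) (cnt ∅) ω (cnt y z))).max
    ((super_hgt (cnt x') (cnt ∅) ω (cnt x z - cnt x' z)).max
      (super_hgt (cnt ∅) (cnt y') ω (cnt y z - cnt y' z)))) ?_ ?_ i j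
  · intro i
    simp only [hgt_zero_right]
    rcases le_total i z with h | h
    · have := cnt_mono x h; omega
    · have := cnt_diff hx h; omega
  · intro j
    simp only [hgt_zero_left]
    rcases le_total (j + 1) z with h | h
    · have := cnt_mono y h; omega
    · have := cnt_diff hy h; omega

/-- The `j`-th row of a configuration. -/
def slice (ω : Finset (ℕ × ℕ)) (j : ℕ) : Finset ℕ := (ω.filter (fun q => q.2 = j)).image Prod.fst

lemma mem_slice {ω : Finset (ℕ × ℕ)} {i j : ℕ} : i ∈ slice ω j ↔ (i, j) ∈ ω := by
  simp [slice]

/-- The horizontal increments at height `j`. -/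
def Xrow (M : ℕ) (x y : Finset ℕ) (ω : Finset (ℕ × ℕ)) : ℕ → Finset ℕ
  | 0 => x
  | j + 1 => rowOut M (Xrow M x y ω j) (slice ω j) (decide (j ∈ y))

lemma Xrow_subset {M : ℕ} {x : Finset ℕ} (hx : x ⊆ Finset.range M) (y : Finset ℕ)
    (ω : Finset (ℕ × ℕ)) (j : ℕ) : Xrow M x y ω j ⊆ Finset.range M := by
  cases j with
  | zero => exact hx
  | succ j => exact Finset.filter_subset _ _

lemma Gam_eq (M : ℕ) (x y : Finset ℕ) (ω : Finset (ℕ × ℕ)) (j : ℕ) :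
    ∀ i ≤ M, Gam x y ω i j = cnt y j + cnt (Xrow M x y ω j) i := by
  induction j with
  | zero => intro i _; simp [Gam, hgt_zero_right, Xrow, cnt_zero]
  | succ j ih =>
    have key : ∀ i ≤ M, Gam x y ω i (j + 1) = cnt y (j + 1) + cnt (Xrow M x y ω (j + 1)) i ∧
        Gam x y ω i (j + 1) = Gam x y ω i j +
          (if jbit (Xrow M x y ω j) (slice ω j) (decide (j ∈ y)) i = true then 1 else 0) := by
      intro i
      induction i with
      | zero =>
        intro _
        have h0 := ih 0 (Nat.zero_le _)
        rw [h0]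
        simp [Gam, hgt_zero_left, cnt_zero, jbit, cnt_succ]
      | succ i ih' =>
        intro hi
        obtain ⟨e1, e2⟩ := ih' (by omega)
        have e3 := ih i (by omega)
        have e4 := ih (i + 1) hi
        have e5 : Gam x y ω (i + 1) (j + 1) = max (Gam x y ω i (j + 1))
          (max (Gam x y ω (i + 1) j) (Gam x y ω i j + if (i, j) ∈ ω then 1 else 0)) :=
          hgt_succ _ _ _ _ _
        have hmem : i ∈ Xrow M x y ω (j + 1) ↔
          ((!(jbit (Xrow M x y ω j) (slice ω j) (decide (j ∈ y)) i) &&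
          (decide (i ∈ Xrow M x y ω j) || decide (i ∈ slice ω j))) = true) := by
          simp only [Xrow, rowOut, Finset.mem_filter, Finset.mem_range]
          exact and_iff_right (by omega)
        rw [cnt_succ _ i] at e4 ⊢
        simp only [hmem]
        simp only [jbit, mem_slice]
        generalize jbit (Xrow M x y ω j) (slice ω j) (decide (j ∈ y)) i = K at *
        by_cases hX : i ∈ Xrow M x y ω j <;> by_cases hw : (i, j) ∈ ω <;> cases K <;>
          simp [hX, hw] at * <;> omega
    intro i hi
    exact (key i hi).1

lemma Xrow_congr {M : ℕ} {x y y' : Finset ℕ} {ω ω' : Finset (ℕ × ℕ)} {N : ℕ}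
    (hy : ∀ j < N, j ∈ y ↔ j ∈ y') (hw : ∀ j < N, slice ω j = slice ω' j) :
    ∀ j ≤ N, Xrow M x y ω j = Xrow M x y' ω' j := by
  intro j
  induction j with
  | zero => intro _; rfl
  | succ j ih =>
    intro hj
    simp only [Xrow]
    rw [ih (by omega), hw j (by omega)]
    simp only [hy j (by omega)]

lemma burke {a b p : ℝ} (h : a * b = p * (1 - a) * (1 - b)) (M N : ℕ)
    (F : Finset ℕ → ℝ) :
    E a (Finset.range M) (fun x => E b (Finset.range N) (fun y =>
      E p (Finset.range M ×ˢ Finset.range N) (fun ω => F (Xrow M x y ω N))))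
    = E a (Finset.range M) F := by
  induction N generalizing F with
  | zero => simp [E_empty, Xrow]
  | succ N ih =>
    have hN : N ∉ Finset.range N := by simp
    have hset : Finset.range M ×ˢ Finset.range (N + 1) =
        (Finset.range M ×ˢ Finset.range N) ∪ (Finset.range M).image (fun i => (i, N)) := by
      ext ⟨i, j⟩
      simp only [Finset.mem_product, Finset.mem_range, Finset.mem_union, Finset.mem_image,
        Prod.mk.injEq]
      constructor
      · rintro ⟨h1, h2⟩
        by_cases hj : j = N
        · exact Or.inr ⟨i, h1, rfl, hj.symm⟩
        · exact Or.inl ⟨h1, by omega⟩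
      · rintro (⟨h1, h2⟩ | ⟨k, h1, h2, h3⟩) <;> omega
    have hdisj : Disjoint (Finset.range M ×ˢ Finset.range N)
        ((Finset.range M).image (fun i => (i, N))) := by
      rw [Finset.disjoint_left]
      rintro ⟨i, j⟩ h1 h2
      simp at h1 h2
      omega
    have hinj : Function.Injective (fun i : ℕ => (i, N)) := fun i k hik => by simpa using hik
    rw [hset, Finset.range_add_one]
    simp only [E_insert _ _ _ hN, E_union _ _ _ hdisj, E_image _ _ _ hinj]
    have step : ∀ x ⊆ Finset.range M, E b (Finset.range N) (fun y => EB b (fun J =>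
        E p (Finset.range M ×ˢ Finset.range N) (fun s => E p (Finset.range M) (fun w =>
          F (Xrow M x (addb J N y) (s ∪ w.image (fun i => (i, N))) (N + 1)))))) =
        E b (Finset.range N) (fun y => E p (Finset.range M ×ˢ Finset.range N) (fun s =>
          (fun X => E p (Finset.range M) (fun w => EB b (fun J => F (rowOut M X w J))))
            (Xrow M x y s N))) := by
      intro x hx
      refine E_congr fun y hy => ?_
      rw [← E_EB_comm]
      refine E_congr fun s hs => ?_
      rw [← E_EB_comm]
      refine E_congr fun w hw => ?_
      congr 1
      funext J
      have hnot : ∀ i, (i, N) ∉ s := fun i hi => by have := hs hi; simp at this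
      have hsl : slice (s ∪ w.image (fun i => (i, N))) N = w := by
        ext i; simp [mem_slice, hnot]
      have hcongr := Xrow_congr (M := M) (x := x) (y := addb J N y) (y' := y)
        (ω := s ∪ w.image (fun i => (i, N))) (ω' := s) (N := N)
        (fun j hj => mem_addb_of_lt hj _)
        (fun j hj => by ext i; simp [mem_slice]; omega) N le_rfl
      simp only [Xrow]
      rw [hcongr, hsl]
      simp only [mem_addb_self hy, Bool.decide_eq_true]
    rw [E_congr step]
    rw [ih (fun X => E p (Finset.range M) (fun w => EB b (fun J => F (rowOut M X w J))))]
    rw [burke_row h M (fun X _ => F X)]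
    refine E_congr fun x _ => ?_
    simp [EB]; ring

/-! ### Chains and permutations -/

/-- Strict chains of lattice points. -/
def IsChn (c : Finset (ℕ × ℕ)) : Prop :=
  ∀ p ∈ c, ∀ q ∈ c, p ≠ q → (p.1 < q.1 ∧ p.2 < q.2) ∨ (q.1 < p.1 ∧ q.2 < p.2)

lemma IsChn.mono {c d : Finset (ℕ × ℕ)} (h : IsChn c) (hd : d ⊆ c) : IsChn d :=
  fun p hp q hq => h p (hd hp) q (hd hq)

lemma H_succ (ω : Finset (ℕ × ℕ)) (i j : ℕ) :
    H ω (i + 1) (j + 1) = max (H ω i (j + 1)) (max (H ω (i + 1) j)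
      (H ω i j + if (i, j) ∈ ω then 1 else 0)) := hgt_succ _ _ _ _ _

lemma H_zero_right (ω : Finset (ℕ × ℕ)) (i : ℕ) : H ω i 0 = 0 := by
  unfold H Gam; rw [hgt_zero_right, cnt_empty]

lemma H_zero_left (ω : Finset (ℕ × ℕ)) (j : ℕ) : H ω 0 j = 0 := by
  cases j with
  | zero => exact H_zero_right _ _
  | succ j => unfold H Gam; rw [hgt_zero_left, cnt_empty]

lemma chain_le {ω : Finset (ℕ × ℕ)} (i j : ℕ) : ∀ c : Finset (ℕ × ℕ), c ⊆ ω → IsChn c →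
    (∀ q ∈ c, q.1 < i ∧ q.2 < j) → c.card ≤ H ω i j := by
  induction j generalizing i with
  | zero =>
    intro c _ _ h
    have : c = ∅ := Finset.eq_empty_of_forall_notMem fun q hq => by have := h q hq; omega
    simp [this]
  | succ j ih =>
    induction i with
    | zero =>
      intro c _ _ h
      have : c = ∅ := Finset.eq_empty_of_forall_notMem fun q hq => by have := h q hq; omega
      simp [this]
    | succ i ih' =>
      intro c hc hch h
      rw [H_succ]
      by_cases hij : (i, j) ∈ c
      · have h1 := ih i (c.erase (i, j)) ((Finset.erase_subset _ _).trans hc)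
          (hch.mono (Finset.erase_subset _ _)) (by
            intro q hq
            rw [Finset.mem_erase] at hq
            have h2 := hch q hq.2 (i, j) hij hq.1
            have h3 := h q hq.2
            simp only at h2
            omega)
        rw [Finset.card_erase_of_mem hij] at h1
        rw [if_pos (hc hij)]
        omega
      · by_cases h1 : ∃ q ∈ c, q.1 = i
        · by_cases h2 : ∃ q ∈ c, q.2 = j
          · exfalso
            obtain ⟨q, hq, hqi⟩ := h1
            obtain ⟨r, hr, hrj⟩ := h2
            have e1 := h q hq
            have e2 := h r hr
            by_cases hqr : q = r
            · subst hqr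
              apply hij
              have : q = (i, j) := Prod.ext hqi hrj
              rwa [← this]
            · have := hch q hq r hr hqr
              omega
          · have := ih (i + 1) c hc hch (fun q hq => by
              have e1 := h q hq
              have : q.2 ≠ j := fun e => h2 ⟨q, hq, e⟩
              omega)
            omega
        · have := ih' c hc hch (fun q hq => by
              have e1 := h q hq
              have : q.1 ≠ i := fun e => h1 ⟨q, hq, e⟩
              omega)
          omega

lemma exists_chain (ω : Finset (ℕ × ℕ)) (i j : ℕ) : ∃ c : Finset (ℕ × ℕ), c ⊆ ω ∧ IsChn c ∧
    (∀ q ∈ c, q.1 < i ∧ q.2 < j) ∧ c.card = H ω i j := by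
  induction j generalizing i with
  | zero => exact ⟨∅, by simp, by simp [IsChn], by simp, by simp [H_zero_right]⟩
  | succ j ih =>
    induction i with
    | zero => exact ⟨∅, by simp, by simp [IsChn], by simp, by simp [H_zero_left]⟩
    | succ i ih' =>
      have hs := H_succ ω i j
      obtain ⟨c1, a1, a2, a3, a4⟩ := ih'
      obtain ⟨c2, b1, b2, b3, b4⟩ := ih (i + 1)
      obtain ⟨c3, d1, d2, d3, d4⟩ := ih i
      by_cases e1 : H ω (i + 1) (j + 1) = H ω i (j + 1)
      · exact ⟨c1, a1, a2, fun q hq => by have := a3 q hq; omega, by omega⟩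
      by_cases e2 : H ω (i + 1) (j + 1) = H ω (i + 1) j
      · exact ⟨c2, b1, b2, fun q hq => by have := b3 q hq; omega, by omega⟩
      by_cases hw : (i, j) ∈ ω
      · rw [if_pos hw] at hs
        have hn : (i, j) ∉ c3 := fun h => by have := d3 _ h; simp at this
        refine ⟨insert (i, j) c3, Finset.insert_subset hw d1, ?_, ?_, ?_⟩
        · intro p hp q hq hpq
          rcases Finset.mem_insert.mp hp with hp | hp <;>
            rcases Finset.mem_insert.mp hq with hq | hq
          · exact absurd (hp.trans hq.symm) hpq
          · subst hp; exact Or.inr (d3 q hq)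
          · subst hq; exact Or.inl (d3 p hp)
          · exact d2 p hp q hq hpq
        · intro q hq
          rcases Finset.mem_insert.mp hq with hq | hq
          · subst hq; simp
          · have := d3 q hq; omega
        · rw [Finset.card_insert_of_notMem hn]; omega
      · rw [if_neg hw] at hs
        exact ⟨c3, d1, d2, fun q hq => by have := d3 q hq; omega, by omega⟩

/-- The points of a permutation placed in rows `c` and columns `r`. -/
def conf {n : ℕ} (r c : Fin n → ℕ) (π : Equiv.Perm (Fin n)) : Finset (ℕ × ℕ) :=
  Finset.univ.image (fun i => (r i, c (π i)))

lemma H_conf {n N : ℕ} {r c : Fin n → ℕ} (hr : StrictMono r) (hc : StrictMono c)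
    (hrN : ∀ i, r i < N) (hcN : ∀ i, c i < N) (π : Equiv.Perm (Fin n)) :
    H (conf r c π) N N = lisLength π := by
  have hinj : Function.Injective (fun i => (r i, c (π i))) := fun i k h => by
    simp only [Prod.mk.injEq] at h; exact hr.injective h.1
  apply le_antisymm
  · obtain ⟨d, h1, h2, h3, h4⟩ := exists_chain (conf r c π) N N
    rw [← h4]
    have hd : d = (Finset.univ.filter (fun i => (r i, c (π i)) ∈ d)).image
        (fun i => (r i, c (π i))) := by
      ext q
      simp only [Finset.mem_image, Finset.mem_filter, Finset.mem_univ, true_and]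
      constructor
      · intro hq
        obtain ⟨i, _, hi⟩ := Finset.mem_image.mp (h1 hq)
        exact ⟨i, by rw [hi]; exact hq, hi⟩
      · rintro ⟨i, hi, rfl⟩; exact hi
    rw [hd, Finset.card_image_of_injective _ hinj]
    unfold lisLength
    apply Finset.le_sup (f := Finset.card)
    simp only [Finset.mem_filter, Finset.mem_univ, true_and]
    intro i hi j hj hij
    have := h2 _ hi _ hj (fun h => hij.ne (hinj h))
    simp only [hr.lt_iff_lt, hc.lt_iff_lt] at this
    rcases this with h | h
    · exact h.2
    · exact absurd h.1 (not_lt.mpr hij.le)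
  · unfold lisLength
    apply Finset.sup_le
    intro s hs
    simp only [Finset.mem_filter, Finset.mem_univ, true_and] at hs
    rw [← Finset.card_image_of_injective s hinj]
    apply chain_le
    · intro q hq
      obtain ⟨i, _, hi⟩ := Finset.mem_image.mp hq
      exact Finset.mem_image.mpr ⟨i, Finset.mem_univ _, hi⟩
    · intro p hp q hq hpq
      obtain ⟨i, hi, rfl⟩ := Finset.mem_image.mp hp
      obtain ⟨j, hj, rfl⟩ := Finset.mem_image.mp hq
      simp only [hr.lt_iff_lt, hc.lt_iff_lt]
      rcases lt_trichotomy i j with h | h | h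
      · exact Or.inl ⟨h, hs i hi j hj h⟩
      · exact absurd (by rw [h]) hpq
      · exact Or.inr ⟨h, hs j hj i hi h⟩
    · intro q hq
      obtain ⟨i, hi, rfl⟩ := Finset.mem_image.mp hq
      exact ⟨hrN _, hcN _⟩

/-- Indicator of a proposition. -/
noncomputable def ind (P : Prop) : ℝ := if P then 1 else 0

lemma ind_nonneg (P : Prop) : 0 ≤ ind P := by unfold ind; split_ifs <;> norm_num

lemma ind_le_one (P : Prop) : ind P ≤ 1 := by unfold ind; split_ifs <;> norm_num

lemma ind_true {P : Prop} (h : P) : ind P = 1 := if_pos h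

lemma ind_false {P : Prop} (h : ¬ P) : ind P = 0 := if_neg h

lemma ind_mono {P Q : Prop} (h : P → Q) : ind P ≤ ind Q := by
  by_cases hP : P
  · rw [ind_true hP, ind_true (h hP)]
  · rw [ind_false hP]; exact ind_nonneg _

lemma transfer {p : ℝ} (h0 : 0 ≤ p) (h1 : p ≤ 1) (n N : ℕ) (B : ℕ → Prop) :
    ((N.choose n : ℝ) ^ 2 * p ^ n * (1 - p) ^ (N ^ 2 - n)) *
      ((Finset.univ.filter (fun π : Equiv.Perm (Fin n) => B (lisLength π))).card : ℝ) ≤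
    E p (Finset.range N ×ˢ Finset.range N) (fun ω => ind (B (H ω N N))) := by
  let K := {s // s ∈ Finset.powersetCard n (Finset.range N)}
  have hK : ∀ R : K, R.1.card = n := fun R => (Finset.mem_powersetCard.mp R.2).2
  have hKN : ∀ (R : K) i, R.1.orderEmbOfFin (hK R) i < N := fun R i => by
    have h1 := Finset.orderEmbOfFin_mem R.1 (hK R) i
    simpa using (Finset.mem_powersetCard.mp R.2).1 h1
  let φ : K × K × Equiv.Perm (Fin n) → Finset (ℕ × ℕ) := fun q =>
    conf (q.1.1.orderEmbOfFin (hK q.1)) (q.2.1.1.orderEmbOfFin (hK q.2.1)) q.2.2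
  have hφ : ∀ q, H (φ q) N N = lisLength q.2.2 := fun q =>
    H_conf (OrderEmbedding.strictMono _) (OrderEmbedding.strictMono _) (hKN _) (hKN _) _
  have hfst : ∀ q, (φ q).image Prod.fst = q.1.1 := by
    intro q
    ext i
    simp only [φ, conf, Finset.image_image, Finset.mem_image, Finset.mem_univ, true_and,
      Function.comp]
    rw [← Finset.mem_coe, ← Finset.range_orderEmbOfFin q.1.1 (hK q.1)]
    simp only [Set.mem_range]
  have hsnd : ∀ q, (φ q).image Prod.snd = q.2.1.1 := by
    intro q
    ext i
    simp only [φ, conf, Finset.image_image, Finset.mem_image, Finset.mem_univ, true_and,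
      Function.comp]
    rw [← Finset.mem_coe, ← Finset.range_orderEmbOfFin q.2.1.1 (hK q.2.1)]
    simp only [Set.mem_range]
    constructor
    · rintro ⟨k, hk⟩; exact ⟨_, hk⟩
    · rintro ⟨k, hk⟩; exact ⟨q.2.2.symm k, by simpa using hk⟩
  have hinj : Function.Injective φ := by
    rintro ⟨R, C, π⟩ ⟨R', C', π'⟩ h
    have e1 : R = R' := Subtype.ext (by
      have a1 := hfst (R, C, π); have a2 := hfst (R', C', π'); rw [h] at a1
      exact a1.symm.trans a2)
    have e2 : C = C' := Subtype.ext (by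
      have a1 := hsnd (R, C, π); have a2 := hsnd (R', C', π'); rw [h] at a1
      exact a1.symm.trans a2)
    subst e1 e2
    have e3 : π = π' := by
      ext i
      have hm : (R.1.orderEmbOfFin (hK R) i, C.1.orderEmbOfFin (hK C) (π i)) ∈ φ (R, C, π') := by
        rw [← h]
        exact Finset.mem_image.mpr ⟨i, Finset.mem_univ _, rfl⟩
      obtain ⟨k, _, hk⟩ := Finset.mem_image.mp hm
      simp only [Prod.mk.injEq, EmbeddingLike.apply_eq_iff_eq] at hk
      obtain ⟨hk1, hk2⟩ := hk
      subst hk1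
      rw [hk2]
    rw [e3]
  have hcard : ∀ q, (φ q).card = n := by
    intro q
    simp only [φ, conf]
    rw [Finset.card_image_of_injective]
    · simp
    · intro i k h
      simpa using congrArg Prod.fst h
  have hsub : ∀ q, φ q ⊆ Finset.range N ×ˢ Finset.range N := by
    intro q z hz
    obtain ⟨k, _, rfl⟩ := Finset.mem_image.mp hz
    simp [hKN]
  have hKc : Fintype.card K = N.choose n := by
    simp [K]
  have h1' : 0 ≤ 1 - p := by linarith
  set T : Finset (K × K × Equiv.Perm (Fin n)) := Finset.univ ×ˢ (Finset.univ ×ˢ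
    (Finset.univ.filter (fun π : Equiv.Perm (Fin n) => B (lisLength π)))) with hT
  have hTc : (T.card : ℝ) = (N.choose n : ℝ) ^ 2 *
      ((Finset.univ.filter (fun π : Equiv.Perm (Fin n) => B (lisLength π))).card : ℝ) := by
    rw [hT, Finset.card_product, Finset.card_product, Finset.card_univ, hKc]
    push_cast; ring
  unfold E
  calc _ = ∑ q ∈ T, p ^ n * (1 - p) ^ (N ^ 2 - n) := by
        rw [Finset.sum_const, nsmul_eq_mul, hTc]; ring
    _ = ∑ ω ∈ T.image φ, p ^ ω.card *
          (1 - p) ^ ((Finset.range N ×ˢ Finset.range N).card - ω.card) *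
          ind (B (H ω N N)) := by
        rw [Finset.sum_image (fun x _ y _ h => hinj h)]
        refine Finset.sum_congr rfl fun q hq => ?_
        have hB : B (lisLength q.2.2) := by
          rw [hT] at hq
          simpa using hq
        rw [hφ, hcard, ind_true hB, Finset.card_product, Finset.card_range, mul_one, sq]
    _ ≤ _ := by
        apply Finset.sum_le_sum_of_subset_of_nonneg
        · intro ω hω
          obtain ⟨q, _, rfl⟩ := Finset.mem_image.mp hω
          exact Finset.mem_powerset.mpr (hsub q)
        · intro ω _ _
          have := ind_nonneg (B (H ω N N))
          positivity

/-! ### Tail bounds -/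

lemma E_nonneg {α : Type*} {a : ℝ} (h0 : 0 ≤ a) (h1 : a ≤ 1) {A : Finset α} {f : Finset α → ℝ}
    (h : ∀ s, 0 ≤ f s) : 0 ≤ E a A f := by
  have := E_mono (A := A) h0 h1 (f := fun _ => 0) (g := f) (fun s _ => h s)
  rwa [E_const] at this

lemma exp_quad {θ : ℝ} (h : |θ| ≤ 1) : Real.exp θ ≤ 1 + θ + θ ^ 2 := by
  have := abs_le.mp (Real.abs_exp_sub_one_sub_id_le h)
  linarith [this.2]

/-- Chernoff bound. -/
lemma chernoff {α : Type*} {a : ℝ} (h0 : 0 ≤ a) (h1 : a ≤ 1) (A : Finset α) {θ c : ℝ}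
    (hθ : |θ| ≤ 1) :
    E a A (fun s => ind (0 ≤ θ * s.card - c)) ≤
      Real.exp (a * A.card * (θ + θ ^ 2) - c) := by
  have step : E a A (fun s => ind (0 ≤ θ * s.card - c)) ≤
      E a A (fun s => Real.exp (-c) * (Real.exp θ) ^ s.card) := by
    refine E_mono h0 h1 fun s _ => ?_
    rw [← Real.exp_nat_mul, ← Real.exp_add]
    by_cases h : 0 ≤ θ * s.card - c
    · rw [ind_true h]
      apply Real.one_le_exp
      linarith [mul_comm θ (s.card : ℝ)]
    · rw [ind_false h]; positivity
  refine step.trans ?_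
  rw [E_mul, E_exp]
  have h2 : a * Real.exp θ + (1 - a) ≤ Real.exp (a * (θ + θ ^ 2)) := by
    have := exp_quad hθ
    have h3 := Real.add_one_le_exp (a * (θ + θ ^ 2))
    nlinarith
  have h4 : 0 ≤ a * Real.exp θ + (1 - a) := by
    have := Real.exp_pos θ
    nlinarith [mul_nonneg h0 this.le]
  calc Real.exp (-c) * (a * Real.exp θ + (1 - a)) ^ A.card
      ≤ Real.exp (-c) * (Real.exp (a * (θ + θ ^ 2))) ^ A.card := by gcongr
    _ = _ := by
      rw [← Real.exp_nat_mul, ← Real.exp_add]; congr 1; ring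

lemma tail_up {α : Type*} {a : ℝ} (h0 : 0 ≤ a) (h1 : a ≤ 1) (A : Finset α) {σ t m : ℝ}
    (hσ : 0 < σ) (hσ1 : σ ≤ 1) (hm : a * A.card ≤ m) (ht : a * A.card ≤ 2 * t) :
    E a A (fun s => ind (m + σ * t ≤ s.card)) ≤ Real.exp (-(σ ^ 2 * t / 8)) := by
  have key := chernoff h0 h1 A (θ := σ / 4) (c := σ / 4 * (m + σ * t))
    (by rw [abs_of_pos (by positivity)]; linarith)
  refine le_trans (E_mono h0 h1 fun s _ => ind_mono fun h => ?_) (key.trans ?_)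
  · have : 0 ≤ σ / 4 * ((s.card : ℝ) - (m + σ * t)) := mul_nonneg (by positivity) (by linarith)
    linarith
  · apply Real.exp_le_exp.mpr
    have e1 : 0 ≤ σ / 4 * (m - a * A.card) := mul_nonneg (by positivity) (by linarith)
    have e2 : 0 ≤ σ ^ 2 / 16 * (2 * t - a * A.card) := mul_nonneg (by positivity) (by linarith)
    nlinarith

lemma tail_low {α : Type*} {a : ℝ} (h0 : 0 ≤ a) (h1 : a ≤ 1) (A : Finset α) {σ t m : ℝ}
    (hσ : 0 < σ) (hσ1 : σ ≤ 1) (hm : m ≤ a * A.card) (ht : a * A.card ≤ 2 * t) :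
    E a A (fun s => ind ((s.card : ℝ) ≤ m - σ * t)) ≤ Real.exp (-(σ ^ 2 * t / 8)) := by
  have key := chernoff h0 h1 A (θ := -(σ / 4)) (c := -(σ / 4) * (m - σ * t))
    (by rw [abs_neg, abs_of_pos (by positivity)]; linarith)
  refine le_trans (E_mono h0 h1 fun s _ => ind_mono fun h => ?_) (key.trans ?_)
  · have : 0 ≤ σ / 4 * ((m - σ * t) - (s.card : ℝ)) := mul_nonneg (by positivity) (by linarith)
    linarith
  · apply Real.exp_le_exp.mpr
    have e1 : 0 ≤ σ / 4 * (a * A.card - m) := mul_nonneg (by positivity) (by linarith)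
    have e2 : 0 ≤ σ ^ 2 / 16 * (2 * t - a * A.card) := mul_nonneg (by positivity) (by linarith)
    nlinarith

/-- Boundary density with parameter `l`. -/
noncomputable def dens (t : ℝ) (N : ℕ) (l : ℝ) : ℝ := l * t / (N + l * t)

section grid
variable {t σ l : ℝ} {N : ℕ}

lemma dens_nonneg (ht : 0 < t) (hl : 0 < l) : 0 ≤ dens t N l := by
  unfold dens; positivity

lemma dens_le_one (ht : 0 < t) (hl : 0 < l) : dens t N l ≤ 1 := by
  unfold dens
  have : 0 < l * t := by positivity
  rw [div_le_one (by positivity)]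
  linarith [(Nat.cast_nonneg N : (0 : ℝ) ≤ N)]

lemma dens_mean_le (ht : 0 < t) (hl : 0 < l) : dens t N l * N ≤ l * t := by
  unfold dens
  have h1 : 0 < l * t := by positivity
  have h2 : (0 : ℝ) ≤ N := Nat.cast_nonneg N
  rw [div_mul_eq_mul_div, div_le_iff₀ (by positivity)]
  nlinarith

lemma dens_mean_ge (ht : 0 < t) (hl : 0 < l) (hl2 : l ≤ 2) (hN : 4 * t ≤ σ * N) :
    l * t - σ * t ≤ dens t N l * N := by
  unfold dens
  have h1 : 0 < l * t := by positivity
  have h2 : (0 : ℝ) ≤ N := Nat.cast_nonneg N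
  rw [div_mul_eq_mul_div, le_div_iff₀ (by positivity)]
  have h3 : l ^ 2 * t ≤ σ * N := by nlinarith
  have h4 : 0 ≤ σ * N := by linarith
  have h5 : 0 ≤ σ := by
    by_contra h
    push Not at h
    nlinarith
  nlinarith [mul_nonneg h5 h1.le, mul_nonneg ht.le (sub_nonneg.mpr h3), mul_nonneg (mul_nonneg h5 h1.le) ht.le]

lemma dens_rel (ht : 0 < t) (hl : 0 < l) (hN : 0 < N) :
    dens t N l * dens t N (1 / l) =
      (t ^ 2 / (N : ℝ) ^ 2) * (1 - dens t N l) * (1 - dens t N (1 / l)) := by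
  unfold dens
  have h2 : (0 : ℝ) < N := Nat.cast_pos.mpr hN
  have h3 : (0 : ℝ) < N + l * t := by positivity
  have h4 : (0 : ℝ) < N + 1 / l * t := by positivity
  have e1 : 1 - l * t / (N + l * t) = N / (N + l * t) := by field_simp; ring
  have e2 : 1 - 1 / l * t / (N + 1 / l * t) = N / (N + 1 / l * t) := by field_simp; ring
  rw [e1, e2]
  generalize (N : ℝ) + l * t = u at *
  generalize (N : ℝ) + 1 / l * t = v at *
  field_simp

lemma E_Gam {a b p : ℝ} (h : a * b = p * (1 - a) * (1 - b)) (hb0 : 0 ≤ b)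
    (ha0 : 0 ≤ a) (ha1 : a ≤ 1) (hb1 : b ≤ 1) (hp0 : 0 ≤ p) (hp1 : p ≤ 1)
    (P : ℕ → Prop) (Q R : ℕ → Prop) (hPQ : ∀ u v, P (u + v) → Q u ∨ R v) :
    E a (Finset.range N) (fun x => E b (Finset.range N) (fun y =>
      E p (Finset.range N ×ˢ Finset.range N) (fun ω => ind (P (Gam x y ω N N))))) ≤
    E b (Finset.range N) (fun y => ind (Q y.card)) +
    E a (Finset.range N) (fun x => ind (R x.card)) := by
  have e1 : E b (Finset.range N) (fun y => ind (Q y.card)) =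
      E a (Finset.range N) (fun x => E b (Finset.range N) (fun y =>
      E p (Finset.range N ×ˢ Finset.range N) (fun ω => ind (Q y.card)))) := by
    simp only [E_const]
  rw [e1, ← burke h N N (fun x => ind (R x.card)), ← E_add]
  refine E_mono ha0 ha1 fun x hx => ?_
  rw [← E_add]
  refine E_mono hb0 hb1 fun y hy => ?_
  rw [← E_add]
  refine E_mono hp0 hp1 fun ω _ => ?_
  rw [Gam_eq N x y ω N N le_rfl, cnt_full hy, cnt_full (Xrow_subset hx y ω N)]
  by_cases hP : P (y.card + (Xrow N x y ω N).card)
  · rw [ind_true hP]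
    rcases hPQ _ _ hP with h1 | h1
    · rw [ind_true h1]; linarith [ind_nonneg (R (Xrow N x y ω N).card)]
    · rw [ind_true h1]; linarith [ind_nonneg (Q y.card)]
  · rw [ind_false hP]; exact add_nonneg (ind_nonneg _) (ind_nonneg _)

lemma Gam_upper (ht : 0 < t) (hσ : 0 < σ) (hσ1 : σ ≤ 1) (hl1 : 1 / 2 ≤ l) (hl2 : l ≤ 2)
    (hN : t ≤ N) :
    E (dens t N l) (Finset.range N) (fun x => E (dens t N (1 / l)) (Finset.range N) (fun y =>
      E (t ^ 2 / (N : ℝ) ^ 2) (Finset.range N ×ˢ Finset.range N) (fun ω =>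
        ind ((l + 1 / l + 2 * σ) * t ≤ Gam x y ω N N)))) ≤ 2 * Real.exp (-(σ ^ 2 * t / 8)) := by
  have hl : 0 < l := by linarith
  have hl' : 0 < 1 / l := by positivity
  have hl'2 : 1 / l ≤ 2 := by rw [div_le_iff₀ hl]; linarith
  have hN0 : (0 : ℝ) < N := by linarith
  have hp1 : t ^ 2 / (N : ℝ) ^ 2 ≤ 1 := by
    rw [div_le_one (by positivity)]; gcongr
  have key := E_Gam (N := N) (dens_rel ht hl (Nat.cast_pos.mp hN0)) (dens_nonneg ht hl')
    (dens_nonneg ht hl) (dens_le_one ht hl) (dens_le_one ht hl') (by positivity) hp1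
    (fun k => (l + 1 / l + 2 * σ) * t ≤ k) (fun k => 1 / l * t + σ * t ≤ k)
    (fun k => l * t + σ * t ≤ k) (by
      intro u v h
      by_contra! h'
      push_cast at h
      nlinarith [h'.1, h'.2])
  refine key.trans ?_
  have b1 := tail_up (dens_nonneg (N := N) ht hl') (dens_le_one ht hl') (Finset.range N) (t := t)
    (m := 1 / l * t) hσ hσ1 (by rw [Finset.card_range]; exact dens_mean_le ht hl')
    (by rw [Finset.card_range]; have := dens_mean_le (N := N) ht hl'; nlinarith)
  have b2 := tail_up (dens_nonneg (N := N) ht hl) (dens_le_one ht hl) (Finset.range N) (t := t)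
    (m := l * t) hσ hσ1 (by rw [Finset.card_range]; exact dens_mean_le ht hl)
    (by rw [Finset.card_range]; have := dens_mean_le (N := N) ht hl; nlinarith)
  linarith

lemma Gam_lower (ht : 0 < t) (hσ : 0 < σ) (hσ1 : σ ≤ 1) (hN : 4 * t ≤ σ * N) :
    E (dens t N 1) (Finset.range N) (fun x => E (dens t N 1) (Finset.range N) (fun y =>
      E (t ^ 2 / (N : ℝ) ^ 2) (Finset.range N ×ˢ Finset.range N) (fun ω =>
        ind ((Gam x y ω N N : ℝ) ≤ (2 - 4 * σ) * t)))) ≤ 2 * Real.exp (-(σ ^ 2 * t / 8)) := by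
  have hl : (0 : ℝ) < 1 := one_pos
  have hN0 : (0 : ℝ) < N := by
    by_contra h
    have : σ * N ≤ 0 := mul_nonpos_of_nonneg_of_nonpos hσ.le (not_lt.mp h)
    linarith
  have hNt : t ≤ N := by nlinarith
  have hp1 : t ^ 2 / (N : ℝ) ^ 2 ≤ 1 := by
    rw [div_le_one (by positivity)]; gcongr
  have hrel := dens_rel ht hl (Nat.cast_pos.mp hN0)
  simp only [div_one] at hrel
  have key := E_Gam (N := N) hrel (dens_nonneg ht hl)
    (dens_nonneg ht hl) (dens_le_one ht hl) (dens_le_one ht hl) (by positivity) hp1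
    (fun k => (k : ℝ) ≤ (2 - 4 * σ) * t) (fun k => (k : ℝ) ≤ (1 * t - σ * t) - σ * t)
    (fun k => (k : ℝ) ≤ (1 * t - σ * t) - σ * t) (by
      intro u v h
      by_contra! h'
      push_cast at h
      nlinarith [h'.1, h'.2])
  refine key.trans ?_
  have b2 := tail_low (dens_nonneg (N := N) ht hl) (dens_le_one ht hl) (Finset.range N) (t := t)
    (m := 1 * t - σ * t) hσ hσ1 (by
      rw [Finset.card_range]; exact dens_mean_ge ht hl (by norm_num) hN)
    (by rw [Finset.card_range]; have := dens_mean_le (N := N) ht hl; nlinarith)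
  linarith

lemma H_upper (ht : 0 < t) (hσ : 0 < σ) (hσ1 : σ ≤ 1) (hN : t ≤ N) :
    E (t ^ 2 / (N : ℝ) ^ 2) (Finset.range N ×ˢ Finset.range N) (fun ω =>
        ind ((2 + 2 * σ) * t ≤ H ω N N)) ≤ 2 * Real.exp (-(σ ^ 2 * t / 8)) := by
  have h0 := Gam_upper (l := 1) ht hσ hσ1 (by norm_num) (by norm_num) hN
  simp only [div_one] at h0
  have hN0 : (0 : ℝ) < N := by linarith
  have hp1 : t ^ 2 / (N : ℝ) ^ 2 ≤ 1 := by
    rw [div_le_one (by positivity)]; gcongr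
  refine le_trans ?_ h0
  rw [← E_const (dens t N 1) (E _ _ _) (Finset.range N)]
  refine E_mono (dens_nonneg ht one_pos) (dens_le_one ht one_pos) fun x _ => ?_
  rw [← E_const (dens t N 1) (E _ _ _) (Finset.range N)]
  refine E_mono (dens_nonneg ht one_pos) (dens_le_one ht one_pos) fun y _ => ?_
  refine E_mono (by positivity) hp1 fun ω _ => ind_mono fun h => ?_
  have h1 : H ω N N ≤ Gam x y ω N N := Gam_mono (by simp) (by simp) ω N N
  have h2 : (H ω N N : ℝ) ≤ Gam x y ω N N := by exact_mod_cast h1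
  linarith

end grid

set_option maxHeartbeats 2000000 in
lemma H_lower {η σ t : ℝ} {N : ℕ} (hη : 0 < η) (hη1 : η ≤ 1 / 3) (hση : σ = η ^ 2 / 10)
    (ht : 1 ≤ t) (hN : 4 * t ≤ σ * N) :
    E (t ^ 2 / (N : ℝ) ^ 2) (Finset.range N ×ˢ Finset.range N) (fun ω =>
        ind ((H ω N N : ℝ) ≤ (2 - 3 * η) * t)) ≤ 10 * Real.exp (-(σ ^ 2 * t / 8)) := by
  have ht0 : 0 < t := by linarith
  have hσ : 0 < σ := by rw [hση]; positivity
  have hσ1 : σ ≤ 1 := by rw [hση]; nlinarith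
  have hN0 : (0 : ℝ) < N := by
    by_contra h
    have : σ * N ≤ 0 := mul_nonpos_of_nonneg_of_nonpos hσ.le (not_lt.mp h)
    linarith
  have hNt : t ≤ N := by nlinarith
  have hp0 : 0 ≤ t ^ 2 / (N : ℝ) ^ 2 := by positivity
  have hp1 : t ^ 2 / (N : ℝ) ^ 2 ≤ 1 := by
    rw [div_le_one (by positivity)]; gcongr
  obtain ⟨l, hl⟩ : ∃ l, l = 1 + η := ⟨_, rfl⟩
  have hl0 : 0 < l := by linarith
  have hl2 : l ≤ 2 := by linarith
  have hl1 : 1 / 2 ≤ l := by linarith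
  have hli : 1 / l ≤ 1 - η + η ^ 2 := by
    rw [div_le_iff₀ hl0, hl]; nlinarith [pow_pos hη 3]
  have hli0 : 0 < 1 / l := by positivity
  have hli1 : 1 / 2 ≤ 1 / l := by
    rw [le_div_iff₀ hl0]; linarith
  have hli2 : 1 / l ≤ 2 := by nlinarith
  obtain ⟨z, hz⟩ : ∃ z, z = ⌊2 * η * N⌋₊ := ⟨_, rfl⟩
  have hz1 : (z : ℝ) ≤ 2 * η * N := by rw [hz]; exact Nat.floor_le (by positivity)
  have hz2 : 2 * η * N < z + 1 := by rw [hz]; exact Nat.lt_floor_add_one _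
  have hzN : z ≤ N := by
    have : (z : ℝ) ≤ N := by nlinarith
    exact_mod_cast this
  obtain ⟨a, ha⟩ : ∃ a, a = dens t N 1 := ⟨_, rfl⟩
  obtain ⟨a', ha'⟩ : ∃ a', a' = dens t N l := ⟨_, rfl⟩
  have ha0 : 0 ≤ a := ha ▸ dens_nonneg ht0 one_pos
  have ha1 : a ≤ 1 := ha ▸ dens_le_one ht0 one_pos
  have ha'0 : 0 ≤ a' := ha' ▸ dens_nonneg ht0 hl0
  have ha'1 : a' ≤ 1 := ha' ▸ dens_le_one ht0 hl0
  have ha1' : a < 1 := by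
    rw [ha]; unfold dens
    rw [div_lt_one (by positivity)]; linarith
  have haa : a ≤ a' := by
    rw [ha, ha']; unfold dens
    rw [div_le_div_iff₀ (by positivity) (by positivity)]
    nlinarith [mul_pos ht0 hN0]
  obtain ⟨r, hr⟩ : ∃ r, r = (a' - a) / (1 - a) := ⟨_, rfl⟩
  have hr0 : 0 ≤ r := by rw [hr]; exact div_nonneg (by linarith) (by linarith)
  have hr1 : r ≤ 1 := by rw [hr, div_le_one (by linarith)]; linarith
  have hrr : 1 - (1 - a) * (1 - r) = a' := by
    have : (1 - a) ≠ 0 := by linarith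
    rw [hr]; field_simp; ring
  -- the means
  have m1 : a * N ≤ t := by have := dens_mean_le (N := N) ht0 one_pos; rw [← ha] at this; linarith
  have m2 : a' * N ≤ l * t := by rw [ha']; exact dens_mean_le ht0 hl0
  have m3 : l * t - σ * t ≤ a' * N := by rw [ha']; exact dens_mean_ge ht0 hl0 hl2 hN
  have m4 : a * z ≤ 2 * η * t := by nlinarith
  have m5 : a' ≤ σ * t := by
    have e1 : a' * N ≤ 2 * t := by nlinarith
    have e2 : a' * N ≤ σ * N := by linarith
    have e3 : a' ≤ σ := le_of_mul_le_mul_right e2 hN0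
    nlinarith
  have m6 : 2 * η * l * t - 2 * σ * t ≤ a' * z := by
    have e1 : 0 ≤ a' * ((z : ℝ) + 1 - 2 * η * N) := mul_nonneg ha'0 (by linarith)
    have e2 : 0 ≤ 2 * η * (a' * N - (l * t - σ * t)) := mul_nonneg (by positivity) (by linarith)
    have e3 : 0 ≤ (1 - 2 * η) * (σ * t) := mul_nonneg (by linarith) (by positivity)
    linarith
  have m7 : a' * z ≤ 2 * t := by
    have : a' * z ≤ a' * N := mul_le_mul_of_nonneg_left (by exact_mod_cast hzN) ha'0
    nlinarith
  obtain ⟨q, hq⟩ : ∃ q, q = Real.exp (-(σ ^ 2 * t / 8)) := ⟨_, rfl⟩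
  rw [← hq]
  set A := Finset.range N with hA
  set W := A ×ˢ A with hW
  set p := t ^ 2 / (N : ℝ) ^ 2 with hp
  -- the bad events
  have B1 : E a A (fun x => E a A (fun y => E p W (fun ω =>
      ind ((Gam x y ω N N : ℝ) ≤ (2 - 4 * σ) * t)))) ≤ 2 * q := by
    rw [ha, hq]; exact Gam_lower ht0 hσ hσ1 hN
  have B2 : E a A (fun x => ind (2 * η * t + σ * t ≤ cnt x z)) ≤ q := by
    have h1 := tail_up ha0 ha1 (Finset.range z) (t := t) (m := 2 * η * t) hσ hσ1
      (by rw [Finset.card_range]; exact m4) (by rw [Finset.card_range]; nlinarith)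
    rw [hq]
    refine le_trans (le_of_eq ?_) h1
    exact E_inter_range a hzN (fun s => ind (2 * η * t + σ * t ≤ s.card))
  have B4 : E a' A (fun x => ind ((cnt x z : ℝ) ≤ (2 * η * l * t - 2 * σ * t) - σ * t)) ≤ q := by
    have h1 := tail_low ha'0 ha'1 (Finset.range z) (t := t)
      (m := 2 * η * l * t - 2 * σ * t) hσ hσ1
      (by rw [Finset.card_range]; exact m6) (by rw [Finset.card_range]; exact m7)
    rw [hq]
    refine le_trans (le_of_eq ?_) h1
    exact E_inter_range a' hzN
      (fun s => ind ((s.card : ℝ) ≤ (2 * η * l * t - 2 * σ * t) - σ * t))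
  have B3 : E a' A (fun x => E p W (fun ω =>
      ind ((l + 1 / l + 2 * σ) * t ≤ Gam x ∅ ω N N))) ≤ 2 * q := by
    have h1 := Gam_upper ht0 hσ hσ1 hl1 hl2 hNt
    rw [hq]
    refine le_trans ?_ h1
    rw [ha']
    refine E_mono (dens_nonneg ht0 hl0) (dens_le_one ht0 hl0) fun x _ => ?_
    rw [← E_const (dens t N (1 / l)) (E _ _ _) (Finset.range N)]
    refine E_mono (dens_nonneg ht0 hli0) (dens_le_one ht0 hli0) fun y _ => ?_
    refine E_mono hp0 hp1 fun ω _ => ind_mono fun h => ?_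
    have h2 : (Gam x ∅ ω N N : ℝ) ≤ Gam x y ω N N := by
      exact_mod_cast Gam_mono (subset_refl x) (by simp) ω N N
    linarith
  have B3' : E a' A (fun y => E p W (fun ω =>
      ind ((l + 1 / l + 2 * σ) * t ≤ Gam ∅ y ω N N))) ≤ 2 * q := by
    have h1 := Gam_upper ht0 hσ hσ1 hli1 hli2 hNt
    rw [one_div_one_div, add_comm (1 / l) l, E_comm] at h1
    rw [hq]
    refine le_trans ?_ h1
    rw [ha']
    refine E_mono (dens_nonneg ht0 hl0) (dens_le_one ht0 hl0) fun x _ => ?_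
    rw [← E_const (dens t N (1 / l)) (E _ _ _) (Finset.range N)]
    refine E_mono (dens_nonneg ht0 hli0) (dens_le_one ht0 hli0) fun y _ => ?_
    refine E_mono hp0 hp1 fun ω _ => ind_mono fun h => ?_
    have h2 : (Gam ∅ x ω N N : ℝ) ≤ Gam y x ω N N := by
      exact_mod_cast Gam_mono (by simp) (subset_refl x) ω N N
    linarith
  -- the union bound
  have det : ∀ x y s : Finset ℕ, ∀ ω : Finset (ℕ × ℕ),
      ind ((H ω N N : ℝ) ≤ (2 - 3 * η) * t) ≤
      ind ((Gam x y ω N N : ℝ) ≤ (2 - 4 * σ) * t) +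
      ind (2 * η * t + σ * t ≤ cnt x z) + ind (2 * η * t + σ * t ≤ cnt y z) +
      ind ((l + 1 / l + 2 * σ) * t ≤ Gam (x ∪ s) ∅ ω N N) +
      ind ((l + 1 / l + 2 * σ) * t ≤ Gam ∅ (y ∪ s) ω N N) +
      ind ((cnt (x ∪ s) z : ℝ) ≤ (2 * η * l * t - 2 * σ * t) - σ * t) +
      ind ((cnt (y ∪ s) z : ℝ) ≤ (2 * η * l * t - 2 * σ * t) - σ * t) := by
    intro x y s ω
    have n1 := ind_nonneg ((Gam x y ω N N : ℝ) ≤ (2 - 4 * σ) * t)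
    have n2 := ind_nonneg (2 * η * t + σ * t ≤ cnt x z)
    have n3 := ind_nonneg (2 * η * t + σ * t ≤ cnt y z)
    have n4 := ind_nonneg ((l + 1 / l + 2 * σ) * t ≤ Gam (x ∪ s) ∅ ω N N)
    have n5 := ind_nonneg ((l + 1 / l + 2 * σ) * t ≤ Gam ∅ (y ∪ s) ω N N)
    have n6 := ind_nonneg ((cnt (x ∪ s) z : ℝ) ≤ (2 * η * l * t - 2 * σ * t) - σ * t)
    have n7 := ind_nonneg ((cnt (y ∪ s) z : ℝ) ≤ (2 * η * l * t - 2 * σ * t) - σ * t)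
    by_cases hH : (H ω N N : ℝ) ≤ (2 - 3 * η) * t
    swap
    · rw [ind_false hH]; positivity
    rw [ind_true hH]
    by_cases h1 : (Gam x y ω N N : ℝ) ≤ (2 - 4 * σ) * t
    · rw [ind_true h1]; linarith
    by_cases h2 : 2 * η * t + σ * t ≤ cnt x z
    · rw [ind_true h2]; linarith
    by_cases h3 : 2 * η * t + σ * t ≤ cnt y z
    · rw [ind_true h3]; linarith
    by_cases h4 : (l + 1 / l + 2 * σ) * t ≤ Gam (x ∪ s) ∅ ω N N
    · rw [ind_true h4]; linarith
    by_cases h5 : (l + 1 / l + 2 * σ) * t ≤ Gam ∅ (y ∪ s) ω N N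
    · rw [ind_true h5]; linarith
    by_cases h6 : (cnt (x ∪ s) z : ℝ) ≤ (2 * η * l * t - 2 * σ * t) - σ * t
    · rw [ind_true h6]; linarith
    by_cases h7 : (cnt (y ∪ s) z : ℝ) ≤ (2 * η * l * t - 2 * σ * t) - σ * t
    · rw [ind_true h7]; linarith
    exfalso
    push Not at h1 h2 h3 h4 h5 h6 h7
    have hc := Gam_compare (x := x) (x' := x ∪ s) (y := y) (y' := y ∪ s)
      Finset.subset_union_left Finset.subset_union_left ω z N N
    have c1 : 2 * η + σ + (2 - 3 * η) ≤ 2 - 4 * σ := by nlinarith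
    have c2 : l + 1 / l + 2 * σ + (2 * η + σ) - (2 * η * l - 3 * σ) ≤ 2 - 4 * σ := by
      have e : 2 * η * l = 2 * η + 2 * η ^ 2 := by rw [hl]; ring
      linarith
    have c1' := mul_le_mul_of_nonneg_right c1 ht0.le
    have c2' := mul_le_mul_of_nonneg_right c2 ht0.le
    rcases le_max_iff.mp hc with hc | hc <;> rcases le_max_iff.mp hc with hc | hc
    · have : (Gam x y ω N N : ℝ) ≤ H ω N N + cnt x z := by exact_mod_cast hc
      linarith
    · have : (Gam x y ω N N : ℝ) ≤ H ω N N + cnt y z := by exact_mod_cast hc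
      linarith
    · have : (Gam x y ω N N : ℝ) ≤ Gam (x ∪ s) ∅ ω N N + (cnt x z - cnt (x ∪ s) z) := by
        exact_mod_cast hc
      linarith
    · have : (Gam x y ω N N : ℝ) ≤ Gam ∅ (y ∪ s) ω N N + (cnt y z - cnt (y ∪ s) z) := by
        exact_mod_cast hc
      linarith
  have big : E p W (fun ω => ind ((H ω N N : ℝ) ≤ (2 - 3 * η) * t)) ≤
      E a A (fun x => E a A (fun y => E r A (fun s => E p W (fun ω =>
      ind ((Gam x y ω N N : ℝ) ≤ (2 - 4 * σ) * t) +
      ind (2 * η * t + σ * t ≤ cnt x z) + ind (2 * η * t + σ * t ≤ cnt y z) +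
      ind ((l + 1 / l + 2 * σ) * t ≤ Gam (x ∪ s) ∅ ω N N) +
      ind ((l + 1 / l + 2 * σ) * t ≤ Gam ∅ (y ∪ s) ω N N) +
      ind ((cnt (x ∪ s) z : ℝ) ≤ (2 * η * l * t - 2 * σ * t) - σ * t) +
      ind ((cnt (y ∪ s) z : ℝ) ≤ (2 * η * l * t - 2 * σ * t) - σ * t))))) := by
    rw [← E_const a (E p W _) A]
    refine E_mono ha0 ha1 fun x _ => ?_
    rw [← E_const a (E p W _) A]
    refine E_mono ha0 ha1 fun y _ => ?_
    rw [← E_const r (E p W _) A]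
    refine E_mono hr0 hr1 fun s _ => ?_
    exact E_mono hp0 hp1 fun ω _ => det x y s ω
  refine big.trans ?_
  simp only [E_add, E_const]
  have f3 : E a A (fun x => E r A (fun s => E p W (fun ω =>
      ind ((l + 1 / l + 2 * σ) * t ≤ Gam (x ∪ s) ∅ ω N N)))) ≤ 2 * q := by
    rw [E_or a r A (fun x => E p W (fun ω =>
      ind ((l + 1 / l + 2 * σ) * t ≤ Gam x ∅ ω N N))), hrr]
    exact B3
  have f3' : E a A (fun y => E r A (fun s => E p W (fun ω =>
      ind ((l + 1 / l + 2 * σ) * t ≤ Gam ∅ (y ∪ s) ω N N)))) ≤ 2 * q := by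
    rw [E_or a r A (fun y => E p W (fun ω =>
      ind ((l + 1 / l + 2 * σ) * t ≤ Gam ∅ y ω N N))), hrr]
    exact B3'
  have f4 : E a A (fun x => E r A (fun s =>
      ind ((cnt (x ∪ s) z : ℝ) ≤ (2 * η * l * t - 2 * σ * t) - σ * t))) ≤ q := by
    rw [E_or a r A (fun x =>
      ind ((cnt x z : ℝ) ≤ (2 * η * l * t - 2 * σ * t) - σ * t)), hrr]
    exact B4
  linarith

/-! ### The weight of permutation configurations -/

lemma factorial_bound (n : ℕ) (hn : 1 ≤ n) :
    (n.factorial : ℝ) ≤ (n : ℝ) ^ (n + 1) * Real.exp (1 - n) := by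
  induction n, hn using Nat.le_induction with
  | base => simp
  | succ n hn ih =>
    have hn0 : (0 : ℝ) < n := by exact_mod_cast hn
    have key : (1 - 1 / ((n + 1 : ℕ) : ℝ)) ^ (n + 1) ≤ Real.exp (-1) :=
      Real.one_sub_div_pow_le_exp_neg (by push_cast; linarith)
    have e1 : 1 - 1 / ((n + 1 : ℕ) : ℝ) = n / (n + 1) := by push_cast; field_simp; ring
    rw [e1, div_pow, div_le_iff₀ (by positivity)] at key
    rw [Nat.factorial_succ]
    push_cast
    have e2 : Real.exp (1 - (n + 1 : ℝ)) = Real.exp (1 - n) * Real.exp (-1) := by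
      rw [← Real.exp_add]; congr 1; ring
    rw [e2]
    calc ((n : ℝ) + 1) * n.factorial ≤ (n + 1) * ((n : ℝ) ^ (n + 1) * Real.exp (1 - n)) := by
          gcongr
      _ ≤ (n + 1) * ((Real.exp (-1) * (n + 1) ^ (n + 1)) * Real.exp (1 - n)) := by gcongr
      _ = _ := by ring

lemma kappa_bound (n : ℕ) (hn : 1 ≤ n) (N : ℕ) (hN : N = 4 * n ^ 2) (p : ℝ)
    (hp : p = n / (N : ℝ) ^ 2) :
    Real.exp (-2) / (2 * n) ≤
      ((N.choose n : ℝ) ^ 2 * p ^ n * (1 - p) ^ (N ^ 2 - n)) * n.factorial := by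
  have hn0 : (1 : ℝ) ≤ n := by exact_mod_cast hn
  have hNr : (N : ℝ) = 4 * (n : ℝ) ^ 2 := by rw [hN]; push_cast; ring
  have hN0 : (0 : ℝ) < N := by rw [hNr]; positivity
  have hnN : n ≤ N := by rw [hN]; nlinarith
  have hp0 : 0 < p := by rw [hp]; positivity
  have hpn : (n + 1) * p ≤ 1 := by
    rw [hp, ← mul_div_assoc, div_le_one (by positivity), hNr]
    nlinarith [pow_le_pow_left₀ (by norm_num) hn0 2, pow_le_pow_left₀ (by norm_num) hn0 4,
      pow_le_pow_right₀ hn0 (show 2 ≤ 4 by norm_num), pow_le_pow_right₀ hn0 (show 1 ≤ 4 by norm_num)]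
  have hp2 : p ≤ 1 / 2 := by nlinarith
  have hfac : (0 : ℝ) < n.factorial := by exact_mod_cast n.factorial_pos
  -- first factor
  have k1 : ((N : ℝ) - n) ^ n ≤ (N.choose n : ℝ) * n.factorial := by
    have h1 := Nat.pow_sub_le_descFactorial N n
    have h2 : N.descFactorial n = n.factorial * N.choose n :=
      Nat.descFactorial_eq_factorial_mul_choose N n
    rw [h2] at h1
    have h3 : ((N + 1 - n : ℕ) : ℝ) ^ n ≤ (n.factorial : ℝ) * N.choose n := by exact_mod_cast h1
    have h4 : (N : ℝ) - n ≤ ((N + 1 - n : ℕ) : ℝ) := by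
      rw [Nat.cast_sub (by omega)]; push_cast; linarith
    have h5 : (0 : ℝ) ≤ (N : ℝ) - n := sub_nonneg.mpr (by exact_mod_cast hnN)
    calc ((N : ℝ) - n) ^ n ≤ ((N + 1 - n : ℕ) : ℝ) ^ n := by gcongr
      _ ≤ _ := by linarith
  have k2 : (N : ℝ) ^ (2 * n) / 2 ≤ (((N : ℝ) - n) ^ n) ^ 2 := by
    have h1 := one_add_mul_le_pow (a := -((n : ℝ) / N)) (by
      have : (n : ℝ) / N ≤ 1 := by rw [div_le_one hN0]; exact_mod_cast hnN
      linarith) (2 * n)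
    have h2 : (1 : ℝ) / 2 ≤ 1 + ((2 * n : ℕ) : ℝ) * -((n : ℝ) / N) := by
      rw [hNr]; push_cast
      have : (n : ℝ) / (4 * (n : ℝ) ^ 2) = 1 / (4 * n) := by field_simp
      rw [this]
      have : 2 * (n : ℝ) * -(1 / (4 * n)) = -(1 / 2) := by field_simp; norm_num
      rw [this]; norm_num
    have h3 : (((N : ℝ) - n) ^ n) ^ 2 = (N : ℝ) ^ (2 * n) * (1 + -((n : ℝ) / N)) ^ (2 * n) := by
      rw [← pow_mul, ← mul_pow, mul_comm n 2]
      congr 1; field_simp; ring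
    rw [h3]
    have h4 : (0 : ℝ) < (N : ℝ) ^ (2 * n) := by positivity
    nlinarith
  have k3 : Real.exp (-(n + 1)) ≤ (1 - p) ^ (N ^ 2 - n) := by
    have h0 : 0 < 1 - p := by linarith
    have h1 : (1 - p)⁻¹ ≤ Real.exp (p / (1 - p)) := by
      have := Real.add_one_le_exp (p / (1 - p))
      have e : p / (1 - p) + 1 = (1 - p)⁻¹ := by field_simp; ring
      linarith
    have h2 : Real.exp (-(p / (1 - p))) ≤ 1 - p := by
      rw [Real.exp_neg]; exact inv_le_of_inv_le₀ h0 h1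
    calc Real.exp (-(n + 1)) ≤ Real.exp ((N ^ 2 : ℕ) * -(p / (1 - p))) := by
          apply Real.exp_le_exp.mpr
          have e : ((N ^ 2 : ℕ) : ℝ) * -(p / (1 - p)) = -(n / (1 - p)) := by
            push_cast
            have : (N : ℝ) ^ 2 * p = n := by rw [hp]; field_simp
            rw [← this]; ring
          rw [e]
          apply neg_le_neg
          rw [div_le_iff₀ h0]; linarith
      _ = Real.exp (-(p / (1 - p))) ^ (N ^ 2) := by rw [← Real.exp_nat_mul]
      _ ≤ (1 - p) ^ (N ^ 2) := by gcongr
      _ ≤ (1 - p) ^ (N ^ 2 - n) := pow_le_pow_of_le_one h0.le (by linarith) (by omega)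
  have k4 := factorial_bound n hn
  have k5 : p ^ n = (n : ℝ) ^ n / (N : ℝ) ^ (2 * n) := by rw [hp, div_pow, ← pow_mul]
  have k6 : (N : ℝ) ^ (2 * n) / 2 ≤ ((N.choose n : ℝ) * n.factorial) ^ 2 := by
    refine k2.trans ?_
    have h5 : (0 : ℝ) ≤ (N : ℝ) - n := sub_nonneg.mpr (by exact_mod_cast hnN)
    gcongr
  have k7 : (n : ℝ) ^ n / 2 ≤ ((N.choose n : ℝ) * n.factorial) ^ 2 * p ^ n := by
    rw [k5]
    calc (n : ℝ) ^ n / 2 = ((N : ℝ) ^ (2 * n) / 2) * ((n : ℝ) ^ n / (N : ℝ) ^ (2 * n)) := by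
          field_simp
      _ ≤ _ := by gcongr
  have k8 : Real.exp (-2) / (2 * n) * n.factorial ≤ (n : ℝ) ^ n / 2 * Real.exp (-(n + 1)) := by
    calc Real.exp (-2) / (2 * n) * n.factorial
        ≤ Real.exp (-2) / (2 * n) * ((n : ℝ) ^ (n + 1) * Real.exp (1 - n)) := by gcongr
      _ = (n : ℝ) ^ n / 2 * (Real.exp (-2) * Real.exp (1 - n)) := by
          field_simp
          ring
      _ = _ := by rw [← Real.exp_add]; congr 2; ring
  have k9 : (n : ℝ) ^ n / 2 * Real.exp (-(n + 1)) ≤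
      ((N.choose n : ℝ) * n.factorial) ^ 2 * p ^ n * (1 - p) ^ (N ^ 2 - n) := by gcongr
  have k10 := k8.trans k9
  have e : ((N.choose n : ℝ) * n.factorial) ^ 2 * p ^ n * (1 - p) ^ (N ^ 2 - n) =
      (((N.choose n : ℝ) ^ 2 * p ^ n * (1 - p) ^ (N ^ 2 - n)) * n.factorial) * n.factorial := by
    ring
  rw [e] at k10
  exact le_of_mul_le_mul_right k10 hfac

lemma uniformPerm_apply (n : ℕ) (P : Equiv.Perm (Fin n) → Prop) :
    uniformPerm n {π | P π} =
      ENNReal.ofReal (((Finset.univ.filter P).card : ℝ) / n.factorial) := by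
  unfold uniformPerm
  rw [PMF.toMeasure_uniformOfFintype_apply _ (by trivial), Fintype.card_perm, Fintype.card_fin,
    ENNReal.ofReal_div_of_pos (by exact_mod_cast n.factorial_pos), ENNReal.ofReal_natCast,
    ENNReal.ofReal_natCast]
  congr 2
  exact Fintype.card_subtype _

lemma main_bound {η σ : ℝ} (hη : 0 < η) (hη1 : η ≤ 1 / 3) (hση : σ = η ^ 2 / 10) (n : ℕ)
    (hn : 1 ≤ n) (hn' : 1 ≤ σ * n) :
    ((Finset.univ.filter (fun π : Equiv.Perm (Fin n) =>
      (2 + 2 * σ) * √n ≤ lisLength π ∨ (lisLength π : ℝ) ≤ (2 - 3 * η) * √n)).card : ℝ) /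
        n.factorial ≤
      24 * Real.exp 2 * (n * Real.exp (-(σ ^ 2 * √n / 8))) := by
  have hn0 : (1 : ℝ) ≤ n := by exact_mod_cast hn
  obtain ⟨N, hN⟩ : ∃ N, N = 4 * n ^ 2 := ⟨_, rfl⟩
  have hNr : (N : ℝ) = 4 * (n : ℝ) ^ 2 := by rw [hN]; push_cast; ring
  obtain ⟨t, ht⟩ : ∃ t, t = √(n : ℝ) := ⟨_, rfl⟩
  have ht2 : t ^ 2 = n := by rw [ht]; exact Real.sq_sqrt (by linarith)
  have ht1 : 1 ≤ t := by rw [ht]; exact Real.one_le_sqrt.mpr hn0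
  have ht0 : 0 < t := by linarith
  have htn : t ≤ n := by nlinarith
  have hσ : 0 < σ := by rw [hση]; positivity
  have hσ1 : σ ≤ 1 := by rw [hση]; nlinarith
  have h4 : 4 * t ≤ σ * N := by rw [hNr]; nlinarith
  have hNt : t ≤ N := by rw [hNr]; nlinarith
  have hN0 : (0 : ℝ) < N := by linarith
  obtain ⟨p, hp⟩ : ∃ p, p = t ^ 2 / (N : ℝ) ^ 2 := ⟨_, rfl⟩
  have hp0 : 0 ≤ p := by rw [hp]; positivity
  have hp1 : p ≤ 1 := by rw [hp, div_le_one (by positivity)]; gcongr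
  have k := kappa_bound n hn N hN p (by rw [hp, ht2])
  have tr := transfer hp0 hp1 n N
    (fun k => (2 + 2 * σ) * t ≤ k ∨ (k : ℝ) ≤ (2 - 3 * η) * t)
  have u1 := H_upper ht0 hσ hσ1 hNt
  have u2 := H_lower hη hη1 hση ht1 h4
  rw [← hp] at u1 u2
  have u3 : E p (Finset.range N ×ˢ Finset.range N) (fun ω =>
      ind ((2 + 2 * σ) * t ≤ (H ω N N : ℝ) ∨ (H ω N N : ℝ) ≤ (2 - 3 * η) * t)) ≤
      12 * Real.exp (-(σ ^ 2 * t / 8)) := by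
    have : E p (Finset.range N ×ˢ Finset.range N) (fun ω =>
      ind ((2 + 2 * σ) * t ≤ (H ω N N : ℝ) ∨ (H ω N N : ℝ) ≤ (2 - 3 * η) * t)) ≤
      E p (Finset.range N ×ˢ Finset.range N) (fun ω => ind ((2 + 2 * σ) * t ≤ H ω N N)) +
      E p (Finset.range N ×ˢ Finset.range N) (fun ω => ind ((H ω N N : ℝ) ≤ (2 - 3 * η) * t)) := by
      rw [← E_add]
      refine E_mono hp0 hp1 fun ω _ => ?_
      have n1 := ind_nonneg ((2 + 2 * σ) * t ≤ H ω N N)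
      have n2 := ind_nonneg ((H ω N N : ℝ) ≤ (2 - 3 * η) * t)
      by_cases h : (2 + 2 * σ) * t ≤ (H ω N N : ℝ) ∨ (H ω N N : ℝ) ≤ (2 - 3 * η) * t
      · rw [ind_true h]
        rcases h with h | h
        · rw [ind_true h] at *; linarith
        · rw [ind_true h] at *; linarith
      · rw [ind_false h]; linarith
    linarith
  rw [← ht]
  have hfac : (0 : ℝ) < n.factorial := by exact_mod_cast n.factorial_pos
  obtain ⟨c, hc⟩ : ∃ c : ℝ, c = ((Finset.univ.filter (fun π : Equiv.Perm (Fin n) =>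
      (2 + 2 * σ) * t ≤ lisLength π ∨ (lisLength π : ℝ) ≤ (2 - 3 * η) * t)).card : ℝ) := ⟨_, rfl⟩
  have hc0 : 0 ≤ c := by rw [hc]; positivity
  have tr' : ((N.choose n : ℝ) ^ 2 * p ^ n * (1 - p) ^ (N ^ 2 - n)) * c ≤
      E p (Finset.range N ×ˢ Finset.range N) (fun ω =>
        ind ((2 + 2 * σ) * t ≤ (H ω N N : ℝ) ∨ (H ω N N : ℝ) ≤ (2 - 3 * η) * t)) := by
    rw [hc]; convert tr
  rw [← hc]
  have tr2 := tr'.trans u3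
  have fin1 : Real.exp (-2) / (2 * n) * (c / n.factorial) ≤
      12 * Real.exp (-(σ ^ 2 * t / 8)) := by
    refine le_trans ?_ tr2
    calc Real.exp (-2) / (2 * n) * (c / n.factorial) ≤
        (((N.choose n : ℝ) ^ 2 * p ^ n * (1 - p) ^ (N ^ 2 - n)) * n.factorial) *
          (c / n.factorial) := by gcongr
      _ = _ := by field_simp
  have e2 : Real.exp 2 * Real.exp (-2) = 1 := by rw [← Real.exp_add]; simp
  have e3 : c / n.factorial = (2 * n * Real.exp 2) *
      (Real.exp (-2) / (2 * n) * (c / n.factorial)) := by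
    calc c / n.factorial = (Real.exp 2 * Real.exp (-2)) * (c / n.factorial) := by rw [e2, one_mul]
      _ = _ := by field_simp
  rw [e3]
  calc _ ≤ (2 * n * Real.exp 2) * (12 * Real.exp (-(σ ^ 2 * t / 8))) := by gcongr
    _ = _ := by ring

lemma bound_tendsto {c : ℝ} (hc : 0 < c) :
    Tendsto (fun n : ℕ => 24 * Real.exp 2 * ((n : ℝ) * Real.exp (-(c ^ 2 * √n / 8))))
      atTop (nhds 0) := by
  have h1 := Real.tendsto_pow_mul_exp_neg_atTop_nhds_zero 2
  have h2 : Tendsto (fun n : ℕ => c ^ 2 / 8 * √(n : ℝ)) atTop atTop :=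
    (Real.tendsto_sqrt_atTop.comp tendsto_natCast_atTop_atTop).const_mul_atTop (by positivity)
  have h3 := (h1.comp h2).const_mul (24 * Real.exp 2 * (8 / c ^ 2) ^ 2)
  rw [mul_zero] at h3
  refine h3.congr fun n => ?_
  simp only [Function.comp]
  have hs : √(n : ℝ) ^ 2 = n := Real.sq_sqrt (Nat.cast_nonneg n)
  have e : c ^ 2 * √(n : ℝ) / 8 = c ^ 2 / 8 * √(n : ℝ) := by ring
  rw [mul_pow, hs, e]
  field_simp

end Ulam

/-- (Vershik–Kerov, Logan–Shepp) The constant in the Ulam problem equals `2`: the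
length `ℓ_n` of the longest increasing subsequence of a uniformly random
permutation of `{1, …, n}` satisfies `ℓ_n / √n → 2` in probability. -/
theorem ulam_constant_eq_two :
    ∀ ε : ℝ, 0 < ε →
      Tendsto
        (fun n : ℕ =>
          uniformPerm n {π | ε < |(lisLength π : ℝ) / Real.sqrt n - 2|})
        atTop (nhds 0) := by
  intro ε hε
  obtain ⟨η, hη⟩ : ∃ η, η = min ε 1 / 3 := ⟨_, rfl⟩
  have hm : 0 < min ε 1 := lt_min hε one_pos
  have hη0 : 0 < η := by rw [hη]; positivity
  have hη1 : η ≤ 1 / 3 := by rw [hη]; have := min_le_right ε 1; linarith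
  have hηε : 3 * η ≤ ε := by rw [hη]; have := min_le_left ε 1; linarith
  obtain ⟨σ, hσ⟩ : ∃ σ, σ = η ^ 2 / 10 := ⟨_, rfl⟩
  have hσ0 : 0 < σ := by rw [hσ]; positivity
  have hσε : 2 * σ ≤ ε := by rw [hσ]; nlinarith
  have lim := ENNReal.tendsto_ofReal (Ulam.bound_tendsto hσ0)
  rw [ENNReal.ofReal_zero] at lim
  refine tendsto_of_tendsto_of_tendsto_of_le_of_le' tendsto_const_nhds lim
    (Eventually.of_forall fun _ => bot_le) ?_
  filter_upwards [eventually_ge_atTop 1, eventually_ge_atTop ⌈1 / σ⌉₊] with n hn hn2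
  have hn' : 1 ≤ σ * n := by
    have h1 : 1 / σ ≤ n := (Nat.le_ceil _).trans (by exact_mod_cast hn2)
    rw [div_le_iff₀ hσ0] at h1
    linarith
  have hM := ENNReal.ofReal_le_ofReal (Ulam.main_bound hη0 hη1 hσ n hn hn')
  have hU := Ulam.uniformPerm_apply n (fun π =>
    (2 + 2 * σ) * √(n : ℝ) ≤ lisLength π ∨ (lisLength π : ℝ) ≤ (2 - 3 * η) * √(n : ℝ))
  refine le_trans ?_ (le_trans (le_of_eq hU) (le_trans (le_of_eq ?_) hM))
  swap
  · congr!
  apply MeasureTheory.measure_mono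
  intro π hπ
  simp only [Set.mem_ofPred_eq] at hπ ⊢
  have hs : 0 < √(n : ℝ) := Real.sqrt_pos.mpr (by exact_mod_cast hn)
  rcases lt_abs.mp hπ with h | h
  · left
    have h1 : 2 + 2 * σ ≤ (lisLength π : ℝ) / √(n : ℝ) := by linarith
    rwa [le_div_iff₀ hs] at h1
  · right
    have h1 : (lisLength π : ℝ) / √(n : ℝ) ≤ 2 - 3 * η := by linarith
    rwa [div_le_iff₀ hs] at h1
end

section
/- (Kingman's subadditive ergodic theorem) Let (Ω, F, P) be a probability space, T : Ω → Ω a measure-preserving transformation, and (X_n)_{n≥1} a sequence of integrable random variables satisfying X_{m+n} ≤ X_m + X_n ∘ T^m for all m, n ≥ 1 and inf_n E[X_n]/n > −∞. Then X_n / n converges almost surely and in L¹ to a T-invariant random variable; if moreover T is ergodic, the limit is the constant γ = lim_{n→∞} E[X_n]/n = inf_{n≥1} E[X_n]/n. -/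
open MeasureTheory Filter

/-- A subadditive process over a measure preserving map. -/
structure SubProc {Ω : Type*} [MeasurableSpace Ω] (μ : Measure Ω) (T : Ω → Ω)
    (X : ℕ → Ω → ℝ) : Prop where
  mp : MeasurePreserving T μ μ
  int : ∀ n, Integrable (X n) μ
  zero : ∀ ω, X 0 ω = 0
  sub : ∀ m n ω, X (m + n) ω ≤ X m ω + X n (T^[m] ω)

/-- The covering sum. -/
def Fcov {Ω : Type*} (T : Ω → Ω) (u v : Ω → ℝ) (N : ℕ) : ℕ → Ω → ℝ
  | 0, _ => 0
  | n + 1, ω => (u ω + if n < N then v ω else 0) + Fcov T u v N n (T ω)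

section Kingman
variable {Ω : Type*} [MeasurableSpace Ω] {μ : Measure Ω} {T : Ω → Ω} {X : ℕ → Ω → ℝ}

lemma Fcov_mono {Ω : Type*} {T : Ω → Ω} {u v : Ω → ℝ} (hu : ∀ ω, 0 ≤ u ω) (hv : ∀ ω, 0 ≤ v ω) (N n l : ℕ) (ω : Ω) :
    Fcov T u v N n (T^[l] ω) ≤ Fcov T u v N (n + l) ω := by
  induction l generalizing ω with
  | zero => simp
  | succ l ih =>
    rw [← add_assoc, Fcov, Function.iterate_succ_apply]
    have h1 := ih (T ω)
    have h2 : 0 ≤ (if n + l < N then v ω else 0) := by split_ifs; exacts [hv ω, le_rfl]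
    have := hu ω
    linarith

lemma int_comp (hT : MeasurePreserving T μ μ) {f : Ω → ℝ} (hf : Integrable f μ) :
    ∫ ω, f (T ω) ∂μ = ∫ ω, f ω ∂μ := by
  conv_rhs => rw [← hT.map_eq]
  rw [integral_map hT.aemeasurable]
  rw [hT.map_eq]; exact hf.aestronglyMeasurable

lemma Fcov_int {u v : Ω → ℝ} (hT : MeasurePreserving T μ μ) (hu : Integrable u μ)
    (hv : Integrable v μ) (N n : ℕ) :
    Integrable (Fcov T u v N n) μ ∧
    ∫ ω, Fcov T u v N n ω ∂μ ≤ n * ∫ ω, u ω ∂μ + (min n N : ℕ) * ∫ ω, v ω ∂μ := by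
  induction n with
  | zero => simp [Fcov]
  | succ n ih =>
    obtain ⟨ih1, ih2⟩ := ih
    have hw : Integrable (fun ω => if n < N then v ω else 0) μ := by
      split_ifs; exacts [hv, integrable_zero _ _ _]
    have hc : Integrable (fun ω => Fcov T u v N n (T ω)) μ := hT.integrable_comp_of_integrable ih1
    have hci : ∫ ω, Fcov T u v N n (T ω) ∂μ = ∫ ω, Fcov T u v N n ω ∂μ := int_comp hT ih1
    have e : Fcov T u v N (n + 1) = fun ω => (u ω + if n < N then v ω else 0) + Fcov T u v N n (T ω) := rfl
    refine ⟨e ▸ (hu.add hw).add hc, ?_⟩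
    have huw : Integrable (fun ω => u ω + if n < N then v ω else 0) μ := hu.add hw
    simp only [e]
    rw [integral_add huw hc, integral_add hu hw, hci]
    push_cast
    by_cases hn : n < N
    · have h1 : min (n + 1) N = n + 1 := by omega
      have h2 : min n N = n := by omega
      have a1 : min ((n:ℝ) + 1) N = n + 1 := by exact_mod_cast congrArg (Nat.cast : ℕ → ℝ) h1
      rw [h2] at ih2
      rw [a1]; simp only [hn, if_true]; linarith
    · have h1 : min (n + 1) N = N := by omega
      have h2 : min n N = N := by omega
      have a1 : min ((n:ℝ) + 1) N = N := by exact_mod_cast congrArg (Nat.cast : ℕ → ℝ) h1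
      rw [h2] at ih2
      rw [a1]; simp only [hn, if_false, integral_zero]; linarith

lemma L0 (h : SubProc μ T X) [IsFiniteMeasure μ]
    (hA : ∀ᵐ ω ∂μ, ∃ n, 1 ≤ n ∧ X n ω ≤ 0) {ε : ℝ} (hε : 0 < ε) :
    ∃ n : ℕ, 1 ≤ n ∧ ∫ ω, X n ω ∂μ ≤ n * ε := by
  classical
  set v : Ω → ℝ := fun ω => max (X 1 ω) 0 with hvdef
  have hv0 : ∀ ω, 0 ≤ v ω := fun ω => le_max_right _ _
  have hv : Integrable v μ := (h.int 1).pos_part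
  set B : ℕ → Set Ω := fun N => {ω | ∀ n, 1 ≤ n → n ≤ N → 0 < X n ω} with hB
  have hBm : ∀ N, NullMeasurableSet (B N) μ := by
    intro N
    have : B N = ⋂ n, ⋂ (_ : 1 ≤ n), ⋂ (_ : n ≤ N), {ω | 0 < X n ω} := by
      ext ω; simp [hB]
    rw [this]
    refine .iInter fun n => .iInter fun _ => .iInter fun _ => ?_
    exact nullMeasurableSet_lt aemeasurable_const (h.int n).aemeasurable
  set u : ℕ → Ω → ℝ := fun N => (B N).indicator v with hu
  have hu0 : ∀ N ω, 0 ≤ u N ω := fun N ω => Set.indicator_nonneg (fun _ _ => hv0 _) _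
  have huint : ∀ N, Integrable (u N) μ := fun N => hv.indicator₀ (hBm N)
  have hlim : Tendsto (fun N => ∫ ω, u N ω ∂μ) atTop (nhds (∫ _, (0:ℝ) ∂μ)) := by
    refine tendsto_integral_of_dominated_convergence v (fun N => (huint N).aestronglyMeasurable) hv
      (fun N => Eventually.of_forall fun ω => ?_) ?_
    · rw [Real.norm_of_nonneg (hu0 N ω)]
      exact Set.indicator_le_self' (fun _ _ => hv0 _) ω
    · filter_upwards [hA] with ω ⟨n, hn, hx⟩
      refine tendsto_const_nhds.congr' ?_
      filter_upwards [eventually_ge_atTop n] with N hN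
      rw [hu]
      refine (Set.indicator_of_notMem ?_ _).symm
      intro hmem
      exact absurd (hmem n hn hN) (not_lt.2 hx)
  rw [integral_zero] at hlim
  obtain ⟨N, hN⟩ := ((tendsto_order.1 hlim).2 (ε / 2) (by positivity)).exists
  have key : ∀ n ω, X n ω ≤ Fcov T (u N) v N n ω := by
    intro n
    induction n using Nat.strong_induction_on with
    | _ n ih =>
    intro ω
    rcases n with _ | n
    · rw [h.zero]; exact le_rfl
    have hstep : X (n + 1) ω ≤ v ω + Fcov T (u N) v N n (T ω) := by
      have h1 := h.sub 1 n ω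
      rw [add_comm 1 n] at h1
      have h2 := ih n (by omega) (T ω)
      have h3 : X 1 ω ≤ v ω := le_max_left _ _
      simp only [Function.iterate_one] at h1
      linarith
    by_cases hn : n < N
    · rw [Fcov, if_pos hn]; linarith [hu0 N ω]
    by_cases hb : ω ∈ B N
    · have : u N ω = v ω := Set.indicator_of_mem hb _
      rw [Fcov, if_neg hn, this]; linarith
    · simp only [hB, Set.mem_ofPred_eq, not_forall, not_lt] at hb
      obtain ⟨l, hl1, hl2, hl⟩ := hb
      have h1 := h.sub l (n + 1 - l) ω
      have h2 := ih (n + 1 - l) (by omega) (T^[l] ω)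
      have h3 := Fcov_mono (T := T) (hu0 N) hv0 N (n + 1 - l) l ω
      rw [Nat.sub_add_cancel (by omega)] at h3
      rw [Nat.add_sub_cancel' (by omega)] at h1
      linarith
  obtain ⟨n, hn⟩ := exists_nat_gt (N * (∫ ω, v ω ∂μ) / (ε / 2))
  rw [div_lt_iff₀ (by positivity)] at hn
  have hV : 0 ≤ ∫ ω, v ω ∂μ := integral_nonneg hv0
  refine ⟨n + 1, by omega, ?_⟩
  obtain ⟨i1, i2⟩ := Fcov_int h.mp (huint N) hv N (n + 1)
  have i3 := integral_mono (h.int (n + 1)) i1 (key (n + 1))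
  have i4 : ((min (n + 1) N : ℕ) : ℝ) * ∫ ω, v ω ∂μ ≤ N * ∫ ω, v ω ∂μ := by
    gcongr; exact min_le_right _ _
  have i5 : ((n + 1 : ℕ) : ℝ) * ∫ ω, u N ω ∂μ ≤ ((n + 1 : ℕ) : ℝ) * (ε / 2) := by gcongr
  push_cast at *
  nlinarith

lemma birk_proc (hT : MeasurePreserving T μ μ) {g : Ω → ℝ} (hg : Integrable g μ) :
    SubProc μ T (birkhoffSum T g) where
  mp := hT
  int n := integrable_finsetSum _ fun i _ => (hT.iterate i).integrable_comp_of_integrable hg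
  zero ω := by simp
  sub m n ω := (birkhoffSum_add T g m n ω).le

lemma birk_integral (hT : MeasurePreserving T μ μ) {g : Ω → ℝ} (hg : Integrable g μ) (n : ℕ) :
    ∫ ω, birkhoffSum T g n ω ∂μ = n * ∫ ω, g ω ∂μ := by
  simp only [birkhoffSum]
  have hi : ∀ i ∈ Finset.range n, Integrable (fun ω => g (T^[i] ω)) μ :=
    fun i _ => (hT.iterate i).integrable_comp_of_integrable hg
  rw [integral_finsetSum _ hi]
  rw [Finset.sum_congr rfl fun i _ => int_comp (hT.iterate i) hg]
  simp

lemma ae_birk (hT : MeasurePreserving T μ μ) {g : Ω → ℝ} (hg : ∀ᵐ ω ∂μ, g (T ω) = g ω) :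
    ∀ᵐ ω ∂μ, ∀ n : ℕ, birkhoffSum T g n ω = n * g ω := by
  have h1 : ∀ᵐ ω ∂μ, ∀ k : ℕ, g (T (T^[k] ω)) = g (T^[k] ω) :=
    ae_all_iff.2 fun k => (hT.iterate k).quasiMeasurePreserving.ae hg
  filter_upwards [h1] with ω h n
  have h2 : ∀ k : ℕ, g (T^[k] ω) = g ω := by
    intro k
    induction k with
    | zero => rfl
    | succ k ih => rw [Function.iterate_succ_apply', h, ih]
  simp [birkhoffSum, h2]

lemma SubProc.sub_birk (h : SubProc μ T X) {g : Ω → ℝ} (hg : Integrable g μ) :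
    SubProc μ T (fun n ω => X n ω - birkhoffSum T g n ω) where
  mp := h.mp
  int n := (h.int n).sub ((birk_proc h.mp hg).int n)
  zero ω := by simp [h.zero]
  sub m n ω := by
    have := h.sub m n ω
    rw [birkhoffSum_add]; linarith

lemma SubProc.sub_birk_int (h : SubProc μ T X) {g : Ω → ℝ} (hg : Integrable g μ) (n : ℕ) :
    ∫ ω, (X n ω - birkhoffSum T g n ω) ∂μ = ∫ ω, X n ω ∂μ - n * ∫ ω, g ω ∂μ := by
  rw [integral_sub (h.int n) ((birk_proc h.mp hg).int n), birk_integral h.mp hg]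

lemma L1lem (h : SubProc μ T X) [IsFiniteMeasure μ] {g : Ω → ℝ} (hg : Integrable g μ)
    (hgT : ∀ᵐ ω ∂μ, g (T ω) = g ω)
    (hA : ∀ᵐ ω ∂μ, ∃ n : ℕ, 1 ≤ n ∧ X n ω ≤ n * g ω) {ε : ℝ} (hε : 0 < ε) :
    ∃ n : ℕ, 1 ≤ n ∧ ∫ ω, X n ω ∂μ ≤ n * (∫ ω, g ω ∂μ + ε) := by
  obtain ⟨n, hn, h1⟩ := L0 (h.sub_birk hg) (by
    filter_upwards [hA, ae_birk h.mp hgT] with ω ⟨n, hn, h1⟩ h2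
    exact ⟨n, hn, by rw [h2]; linarith⟩) hε
  refine ⟨n, hn, ?_⟩
  rw [h.sub_birk_int hg] at h1
  linarith

lemma small_prob [IsProbabilityMeasure μ] (hT : MeasurePreserving T μ μ) {H : Ω → ℝ}
    (hH : Integrable H μ) (h0 : ∀ ω, 0 ≤ H ω) {δ : ℝ} (hδ : 0 < δ) :
    ∀ᵐ ω ∂μ, ∀ᶠ n : ℕ in atTop, H (T^[n] ω) ≤ δ * n := by
  let _ : MeasureSpace Ω := ⟨μ⟩
  have : IsProbabilityMeasure (volume : Measure Ω) := ‹IsProbabilityMeasure μ›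
  have h1 := ProbabilityTheory.tsum_prob_mem_Ioi_lt_top (X := fun ω => H ω / δ)
    (hH.div_const δ) (fun ω => div_nonneg (h0 ω) hδ.le)
  have h2 : ∀ j : ℕ, μ ((T^[j]) ⁻¹' {ω | H ω / δ ∈ Set.Ioi (j : ℝ)}) =
      μ {ω | H ω / δ ∈ Set.Ioi (j : ℝ)} := fun j =>
    (hT.iterate j).measure_preimage
      (nullMeasurableSet_lt aemeasurable_const (hH.div_const δ).aemeasurable)
  have h3 : (∑' j : ℕ, μ ((T^[j]) ⁻¹' {ω | H ω / δ ∈ Set.Ioi (j : ℝ)})) ≠ ⊤ := by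
    simp_rw [h2]; exact h1.ne
  filter_upwards [ae_eventually_notMem h3] with ω h
  filter_upwards [h] with n hn
  simp only [Set.mem_preimage, Set.mem_ofPred_eq, Set.mem_Ioi, not_lt] at hn
  rw [div_le_iff₀ hδ] at hn
  linarith

lemma small_fin [IsFiniteMeasure μ] (hT : MeasurePreserving T μ μ) {H : Ω → ℝ}
    (hH : Integrable H μ) (h0 : ∀ ω, 0 ≤ H ω) {δ : ℝ} (hδ : 0 < δ) :
    ∀ᵐ ω ∂μ, ∀ᶠ n : ℕ in atTop, H (T^[n] ω) ≤ δ * n := by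
  rcases eq_zero_or_neZero μ with h | h
  · subst h; simp
  have hc : (μ Set.univ)⁻¹ ≠ 0 := ENNReal.inv_ne_zero.2 (measure_ne_top _ _)
  have hc' : (μ Set.univ)⁻¹ ≠ ⊤ := ENNReal.inv_ne_top.2 (NeZero.ne _)
  have h1 := small_prob (μ := (μ Set.univ)⁻¹ • μ) (hT.smul_measure _) (hH.smul_measure hc') h0 hδ
  exact (Measure.ae_ennreal_smul_measure_iff hc).1 h1

lemma block (h : SubProc μ T X) (k n : ℕ) (ω : Ω) :
    X (k * n) ω ≤ birkhoffSum (T^[k]) (X k) n ω := by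
  induction n generalizing ω with
  | zero => simp [h.zero]
  | succ n ih =>
    rw [birkhoffSum_succ', Nat.mul_succ, add_comm]
    exact (h.sub _ _ _).trans (by gcongr; exact ih _)

lemma U0 (h : SubProc μ T X) [IsFiniteMeasure μ] {δ : ℝ} (hδ : 0 < δ)
    (hA : ∀ᵐ ω ∂μ, ∃ᶠ n : ℕ in atTop, δ * n ≤ X n ω) {k : ℕ} (hk : 1 ≤ k) :
    0 ≤ ∫ ω, X k ω ∂μ := by
  set H : Ω → ℝ := fun ω => ∑ r ∈ Finset.range k, |X r ω| with hHd
  have hH : Integrable H μ := integrable_finsetSum _ fun r _ => (h.int r).abs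
  have hH0 : ∀ ω, 0 ≤ H ω := fun ω => Finset.sum_nonneg fun r _ => abs_nonneg _
  have hs := small_fin h.mp hH hH0 hδ
  have hneg : Integrable (fun ω => - X k ω) μ := (h.int k).neg
  have hT' := h.mp.iterate k
  have hcov : ∀ᵐ ω ∂μ, ∃ n : ℕ, 1 ≤ n ∧ birkhoffSum (T^[k]) (fun ω => - X k ω) n ω ≤ 0 := by
    filter_upwards [hA, hs] with ω h1 h2
    obtain ⟨J, hJ⟩ := eventually_atTop.1 h2
    obtain ⟨m, hm, hm1⟩ := (frequently_atTop.1 h1) (k * (J + 1))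
    have hdm := Nat.div_add_mod m k
    have hr : m % k < k := Nat.mod_lt _ (by omega)
    have hq : J + 1 ≤ m / k := (Nat.le_div_iff_mul_le (by omega)).2 (by rw [mul_comm]; exact hm)
    refine ⟨m / k, by omega, ?_⟩
    have e1 := h.sub (k * (m / k)) (m % k) ω
    rw [hdm] at e1
    have e2 := block h k (m / k) ω
    have e3 : X (m % k) (T^[k * (m / k)] ω) ≤ H (T^[k * (m / k)] ω) :=
      (le_abs_self _).trans (Finset.single_le_sum (f := fun r => |X r (T^[k * (m / k)] ω)|)
        (fun r _ => abs_nonneg _) (Finset.mem_range.2 hr))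
    have e4 := hJ (k * (m / k)) (by nlinarith)
    have e5 : δ * ((k * (m / k) : ℕ) : ℝ) ≤ δ * m := by
      gcongr; exact Nat.mul_div_le m k
    have e6 : birkhoffSum (T^[k]) (fun ω => - X k ω) (m / k) ω
        = - birkhoffSum (T^[k]) (X k) (m / k) ω := by simp [birkhoffSum]
    rw [e6]; linarith
  by_contra! hlt
  obtain ⟨n, hn, hle⟩ := L0 (birk_proc hT' hneg) hcov (ε := - (∫ ω, X k ω ∂μ) / 2) (by linarith)
  rw [birk_integral hT' hneg, integral_neg] at hle
  have : (1:ℝ) ≤ n := by exact_mod_cast hn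
  nlinarith

lemma U1 (h : SubProc μ T X) [IsFiniteMeasure μ] {g : Ω → ℝ} (hg : Integrable g μ)
    (hgT : ∀ᵐ ω ∂μ, g (T ω) = g ω) {δ : ℝ} (hδ : 0 < δ)
    (hA : ∀ᵐ ω ∂μ, ∃ᶠ n : ℕ in atTop, (g ω + δ) * n ≤ X n ω) {k : ℕ} (hk : 1 ≤ k) :
    k * ∫ ω, g ω ∂μ ≤ ∫ ω, X k ω ∂μ := by
  have := U0 (h.sub_birk hg) hδ (by
    filter_upwards [hA, ae_birk h.mp hgT] with ω h1 h2
    refine h1.mono fun n hn => ?_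
    rw [h2]; linarith) hk
  rw [h.sub_birk_int hg] at this
  linarith

lemma ae_inv_restrict [IsFiniteMeasure μ] (hT : MeasurePreserving T μ μ) {E : Set Ω}
    (hE : NullMeasurableSet E μ) (hinv : T ⁻¹' E =ᵐ[μ] E) :
    MeasurePreserving T (μ.restrict E) (μ.restrict E) := by
  obtain ⟨E', hm, he⟩ := hE
  have h1 : T ⁻¹' E =ᵐ[μ] T ⁻¹' E' := hT.quasiMeasurePreserving.preimage_ae_eq he
  have h2 := hT.restrict_preimage hm
  rwa [Measure.restrict_congr_set (h1.symm.trans hinv), ← Measure.restrict_congr_set he] at h2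

lemma SubProc.restrict (h : SubProc μ T X) [IsFiniteMeasure μ] {E : Set Ω}
    (hE : NullMeasurableSet E μ) (hinv : T ⁻¹' E =ᵐ[μ] E) : SubProc (μ.restrict E) T X :=
  ⟨ae_inv_restrict h.mp hE hinv, fun n => (h.int n).restrict, h.zero, h.sub⟩

lemma half_inv [IsFiniteMeasure μ] (hT : MeasurePreserving T μ μ) {E : Set Ω}
    (hE : NullMeasurableSet E μ) (hinv : T ⁻¹' E ⊆ E) : T ⁻¹' E =ᵐ[μ] E :=
  ae_eq_of_subset_of_measure_ge hinv (hT.measure_preimage hE).ge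
    (hE.preimage hT.quasiMeasurePreserving) (measure_ne_top _ _)

lemma half_inv' [IsFiniteMeasure μ] (hT : MeasurePreserving T μ μ) {E : Set Ω}
    (hE : NullMeasurableSet E μ) (hinv : E ⊆ T ⁻¹' E) : T ⁻¹' E =ᵐ[μ] E :=
  (ae_eq_of_subset_of_measure_ge hinv (hT.measure_preimage hE).le
    hE (measure_ne_top _ _)).symm

/-- liminf below `a`. -/
def Dset {Ω : Type*} (X : ℕ → Ω → ℝ) (a : ℝ) : Set Ω :=
  {ω | ∃ q : ℕ, ∃ᶠ n : ℕ in atTop, X n ω < (a - 1 / ((q : ℝ) + 1)) * n}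

/-- limsup above `b`. -/
def Uset {Ω : Type*} (X : ℕ → Ω → ℝ) (b : ℝ) : Set Ω :=
  {ω | ∃ q : ℕ, ∃ᶠ n : ℕ in atTop, (b + 1 / ((q : ℝ) + 1)) * n < X n ω}

lemma Dset_meas (h : SubProc μ T X) (a : ℝ) : NullMeasurableSet (Dset X a) μ := by
  have : Dset X a = ⋃ q : ℕ, ⋂ N : ℕ, ⋃ n : ℕ, ⋃ (_ : N ≤ n),
      {ω | X n ω < (a - 1 / ((q : ℝ) + 1)) * n} := by
    ext ω; simp [Dset, frequently_atTop]
  rw [this]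
  exact .iUnion fun q => .iInter fun N => .iUnion fun n => .iUnion fun _ =>
    nullMeasurableSet_lt (h.int n).aemeasurable aemeasurable_const

lemma Uset_meas (h : SubProc μ T X) (b : ℝ) : NullMeasurableSet (Uset X b) μ := by
  have : Uset X b = ⋃ q : ℕ, ⋂ N : ℕ, ⋃ n : ℕ, ⋃ (_ : N ≤ n),
      {ω | (b + 1 / ((q : ℝ) + 1)) * n < X n ω} := by
    ext ω; simp [Uset, frequently_atTop]
  rw [this]
  exact .iUnion fun q => .iInter fun N => .iUnion fun n => .iUnion fun _ =>
    nullMeasurableSet_lt aemeasurable_const (h.int n).aemeasurable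

lemma ev_large (C : ℝ) {d : ℝ} (hd : 0 < d) : ∀ᶠ n : ℕ in atTop, C < d * n :=
  (tendsto_natCast_atTop_atTop.const_mul_atTop hd).eventually_gt_atTop C

lemma freq_shift {p : ℕ → Prop} : (∃ᶠ n in atTop, p (n + 1)) ↔ ∃ᶠ n in atTop, p n := by
  conv_rhs => rw [← map_add_atTop_eq_nat 1]
  rw [frequently_map]

lemma gap_pos (q : ℕ) : 0 < 1 / ((q : ℝ) + 1) - 1 / (((q + 1 : ℕ) : ℝ) + 1) := by
  rw [sub_pos]
  push_cast
  apply one_div_lt_one_div_of_lt <;> nlinarith [(Nat.cast_nonneg q : (0:ℝ) ≤ q)]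

lemma Dset_inv (h : SubProc μ T X) (a : ℝ) : T ⁻¹' (Dset X a) ⊆ Dset X a := by
  rintro ω ⟨q, hq⟩
  refine ⟨q + 1, freq_shift.1 ?_⟩
  refine (hq.and_eventually (ev_large (X 1 ω - a + 1 / (((q + 1 : ℕ) : ℝ) + 1))
    (gap_pos q))).mono fun n ⟨h1, h2⟩ => ?_
  have h3 := h.sub 1 n ω
  rw [add_comm 1 n, Function.iterate_one] at h3
  rw [Nat.cast_add_one n]
  linarith

lemma Uset_inv (h : SubProc μ T X) (b : ℝ) : Uset X b ⊆ T ⁻¹' (Uset X b) := by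
  rintro ω ⟨q, hq⟩
  refine ⟨q + 1, ?_⟩
  refine ((freq_shift.2 hq).and_eventually (ev_large (X 1 ω - b - 1 / ((q : ℝ) + 1))
    (gap_pos q))).mono fun n ⟨h1, h2⟩ => ?_
  have h3 := h.sub 1 n ω
  rw [add_comm 1 n, Function.iterate_one] at h3
  rw [Nat.cast_add_one n] at h1
  linarith

lemma freq_ge_one {p : ℕ → Prop} (h : ∃ᶠ n in atTop, p n) : ∃ n, 1 ≤ n ∧ p n :=
  ((h.and_eventually (eventually_ge_atTop 1)).exists).imp fun _ h => ⟨h.2, h.1⟩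

lemma low_D (h : SubProc μ T X) [IsFiniteMeasure μ] {a : ℝ} (hD : ∀ᵐ ω ∂μ, ω ∈ Dset X a)
    {ε : ℝ} (hε : 0 < ε) :
    ∃ n : ℕ, 1 ≤ n ∧ ∫ ω, X n ω ∂μ ≤ n * (a * μ.real Set.univ + ε) := by
  obtain ⟨n, hn, h1⟩ := L1lem h (g := fun _ => a) (integrable_const _) (by simp) (by
    filter_upwards [hD] with ω ⟨q, hq⟩
    obtain ⟨n, hn, h1⟩ := freq_ge_one hq
    refine ⟨n, hn, h1.le.trans ?_⟩
    rw [mul_comm]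
    gcongr
    have : 0 < 1 / ((q : ℝ) + 1) := by positivity
    linarith) hε
  refine ⟨n, hn, h1.trans (le_of_eq ?_)⟩
  simp [mul_comm]

lemma up_U (h : SubProc μ T X) [IsFiniteMeasure μ] {b : ℝ} (hU : ∀ᵐ ω ∂μ, ω ∈ Uset X b)
    {k : ℕ} (hk : 1 ≤ k) : k * (b * μ.real Set.univ) ≤ ∫ ω, X k ω ∂μ := by
  have key : ∀ δ : ℝ, 0 < δ → k * ((b - δ) * μ.real Set.univ) ≤ ∫ ω, X k ω ∂μ := by
    intro δ hδ
    have := U1 h (g := fun _ => b - δ) (integrable_const _) (by simp) hδ (by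
      filter_upwards [hU] with ω ⟨q, hq⟩
      refine hq.mono fun n hn => le_trans ?_ hn.le
      refine mul_le_mul_of_nonneg_right ?_ (Nat.cast_nonneg _)
      have : 0 < 1 / ((q : ℝ) + 1) := by positivity
      linarith) hk
    refine le_trans (le_of_eq ?_) this
    simp [mul_comm]
  have hlim : Tendsto (fun δ : ℝ => k * ((b - δ) * μ.real Set.univ)) (nhdsWithin 0 (Set.Ioi 0))
      (nhds (k * ((b - 0) * μ.real Set.univ))) := by
    refine Tendsto.mono_left (Continuous.tendsto ?_ 0) nhdsWithin_le_nhds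
    fun_prop
  rw [sub_zero] at hlim
  exact le_of_tendsto hlim (eventually_nhdsWithin_of_forall fun δ hδ => key δ hδ)

lemma real_zero_ae [IsFiniteMeasure μ] {E : Set Ω} (h : (μ.restrict E).real Set.univ ≤ 0) :
    ∀ᵐ ω ∂μ, ω ∉ E := by
  rw [Measure.real, Measure.restrict_apply_univ] at h
  have h2 : μ E = 0 := by
    have := le_antisymm h ENNReal.toReal_nonneg
    rw [ENNReal.toReal_eq_zero_iff] at this
    exact this.resolve_right (measure_ne_top _ _)
  exact measure_eq_zero_iff_ae_notMem.1 h2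

lemma ae_mem_restrict [IsFiniteMeasure μ] {E : Set Ω} (hE : NullMeasurableSet E μ) :
    ∀ᵐ ω ∂(μ.restrict E), ω ∈ E := ae_restrict_mem₀ hE

lemma no_gap (h : SubProc μ T X) [IsFiniteMeasure μ] {a b : ℝ} (hab : a < b) :
    ∀ᵐ ω ∂μ, ¬ (ω ∈ Dset X a ∧ ω ∈ Uset X b) := by
  have hD := Dset_meas h a
  have hU := Uset_meas h b
  have hE := hD.inter hU
  have hinv : T ⁻¹' (Dset X a ∩ Uset X b) =ᵐ[μ] (Dset X a ∩ Uset X b : Set Ω) :=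
    (half_inv h.mp hD (Dset_inv h a)).inter (half_inv' h.mp hU (Uset_inv h b))
  have h' := h.restrict hE hinv
  have hm := ae_mem_restrict hE
  apply real_zero_ae
  set m := (μ.restrict (Dset X a ∩ Uset X b)).real Set.univ
  by_contra! hpos
  obtain ⟨n, hn, h1⟩ := low_D h' (a := a) (by filter_upwards [hm] with ω hω using hω.1)
    (ε := (b - a) * m / 2) (by have := sub_pos.2 hab; positivity)
  have h2 := up_U h' (b := b) (by filter_upwards [hm] with ω hω using hω.2) hn
  have h3 := le_of_mul_le_mul_left (h2.trans h1) (by exact_mod_cast hn)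
  have : 0 < (b - a) * m := mul_pos (sub_pos.2 hab) hpos
  change b * m ≤ a * m + (b - a) * m / 2 at h3
  nlinarith

lemma bdd_above (h : SubProc μ T X) [IsFiniteMeasure μ] :
    ∀ᵐ ω ∂μ, ∃ q : ℕ, ω ∉ Uset X q := by
  have hE : NullMeasurableSet (⋂ q : ℕ, Uset X q) μ := .iInter fun q => Uset_meas h q
  have hinv : T ⁻¹' (⋂ q : ℕ, Uset X q) =ᵐ[μ] (⋂ q : ℕ, Uset X q : Set Ω) :=
    half_inv' h.mp hE (by
      rw [Set.preimage_iInter]; exact Set.iInter_mono fun q => Uset_inv h q)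
  have h' := h.restrict hE hinv
  have hm := ae_mem_restrict hE
  have := real_zero_ae (μ := μ) (E := ⋂ q : ℕ, Uset X q) (by
    set m := (μ.restrict (⋂ q : ℕ, Uset X q)).real Set.univ with hmdef
    by_contra! hpos
    obtain ⟨q, hq⟩ := exists_nat_gt ((∫ ω, X 1 ω ∂(μ.restrict (⋂ q : ℕ, Uset X q))) / m)
    rw [div_lt_iff₀ hpos] at hq
    have h2 := up_U h' (b := q) (by
      filter_upwards [hm] with ω hω using Set.mem_iInter.1 hω q) (k := 1) le_rfl
    rw [← hmdef, Nat.cast_one, one_mul] at h2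
    linarith)
  filter_upwards [this] with ω hω
  simpa using hω

lemma int_pos_le (h : SubProc μ T X) [IsFiniteMeasure μ] (n : ℕ) :
    ∫ ω, max (X n ω) 0 ∂μ ≤ n * ∫ ω, max (X 1 ω) 0 ∂μ := by
  have hv : Integrable (fun ω => max (X 1 ω) 0) μ := (h.int 1).pos_part
  rw [← birk_integral h.mp hv]
  refine integral_mono (h.int n).pos_part ((birk_proc h.mp hv).int n) fun ω => ?_
  refine max_le ?_ (Finset.sum_nonneg fun _ _ => le_max_right _ _)
  have := block h 1 n ω
  rw [one_mul, Function.iterate_one] at this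
  exact this.trans (Finset.sum_le_sum fun _ _ => le_max_left _ _)

lemma bdd_below (h : SubProc μ T X) [IsFiniteMeasure μ] {c : ℝ}
    (hc : ∀ n : ℕ, c * n ≤ ∫ ω, X n ω ∂μ) :
    ∀ᵐ ω ∂μ, ∃ q : ℕ, ω ∉ Dset X (-q) := by
  have hE : NullMeasurableSet (⋂ q : ℕ, Dset X (-q)) μ := .iInter fun q => Dset_meas h _
  have hinv : T ⁻¹' (⋂ q : ℕ, Dset X (-q)) =ᵐ[μ] (⋂ q : ℕ, Dset X (-q) : Set Ω) :=
    half_inv h.mp hE (by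
      rw [Set.preimage_iInter]; exact Set.iInter_mono fun q => Dset_inv h _)
  have h' := h.restrict hE hinv
  have hm := ae_mem_restrict hE
  set E : Set Ω := ⋂ q : ℕ, Dset X (-q)
  have := real_zero_ae (μ := μ) (E := E) (by
    set m := (μ.restrict E).real Set.univ with hmdef
    set V := ∫ ω, max (X 1 ω) 0 ∂μ with hV
    by_contra! hpos
    obtain ⟨q, hq⟩ := exists_nat_gt ((1 + V - c) / m)
    rw [div_lt_iff₀ hpos] at hq
    obtain ⟨n, hn, h1⟩ := low_D h' (a := -q) (by
      filter_upwards [hm] with ω hω using Set.mem_iInter.1 hω q) one_pos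
    have h2 : ∫ ω, X n ω ∂μ ≤ ∫ ω in E, X n ω ∂μ + n * V := by
      rw [← integral_add_compl₀ hE (h.int n)]
      gcongr
      calc ∫ ω in Eᶜ, X n ω ∂μ ≤ ∫ ω in Eᶜ, max (X n ω) 0 ∂μ :=
            integral_mono (h.int n).restrict (h.int n).pos_part.restrict fun ω => le_max_left _ _
        _ ≤ ∫ ω, max (X n ω) 0 ∂μ := setIntegral_le_integral (h.int n).pos_part
            (Eventually.of_forall fun ω => le_max_right _ _)
        _ ≤ n * V := int_pos_le h n
    have h3 := hc n
    rw [← hmdef] at h1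
    have h4 : (n : ℝ) * c ≤ n * (-q * m + 1 + V) := by linarith
    have h5 := le_of_mul_le_mul_left h4 (by exact_mod_cast hn)
    linarith)
  filter_upwards [this] with ω hω
  simpa [E] using hω

lemma ae_conv (h : SubProc μ T X) [IsFiniteMeasure μ] {c : ℝ}
    (hc : ∀ n : ℕ, c * n ≤ ∫ ω, X n ω ∂μ) :
    ∀ᵐ ω ∂μ, ∃ y : ℝ, Tendsto (fun n : ℕ => X n ω / n) atTop (nhds y) := by
  have h1 : ∀ᵐ ω ∂μ, ∀ a b : ℚ, a < b → ¬ (ω ∈ Dset X a ∧ ω ∈ Uset X b) := by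
    rw [ae_all_iff]; intro a
    rw [ae_all_iff]; intro b
    by_cases hab : a < b
    · filter_upwards [no_gap h (a := a) (b := b) (by exact_mod_cast hab)] with ω hω _ using hω
    · exact Eventually.of_forall fun ω h => absurd h hab
  filter_upwards [h1, bdd_above h, bdd_below h hc] with ω h1 ⟨q1, h2⟩ ⟨q2, h3⟩
  refine tendsto_of_no_upcrossings (s := Set.range ((↑) : ℚ → ℝ)) Rat.denseRange_cast ?_ ?_ ?_
  · rintro _ ⟨a, rfl⟩ _ ⟨b, rfl⟩ hab ⟨f1, f2⟩
    have hab' : a < b := by exact_mod_cast hab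
    obtain ⟨m1, hm1, hm1'⟩ := exists_between hab'
    obtain ⟨m2, hm2, hm2'⟩ := exists_between hm1'
    refine h1 m1 m2 hm2 ⟨?_, ?_⟩
    · obtain ⟨q, hq⟩ := exists_nat_one_div_lt (K := ℝ) (ε := m1 - a)
        (by rw [sub_pos]; exact_mod_cast hm1)
      refine ⟨q, (f1.and_eventually (eventually_ge_atTop 1)).mono fun n ⟨hn, hn1⟩ => ?_⟩
      have hn0 : (0:ℝ) < n := by exact_mod_cast hn1
      rw [div_lt_iff₀ hn0] at hn
      refine hn.trans_le ?_
      gcongr; linarith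
    · obtain ⟨q, hq⟩ := exists_nat_one_div_lt (K := ℝ) (ε := b - m2)
        (by rw [sub_pos]; exact_mod_cast hm2')
      refine ⟨q, (f2.and_eventually (eventually_ge_atTop 1)).mono fun n ⟨hn, hn1⟩ => ?_⟩
      have hn0 : (0:ℝ) < n := by exact_mod_cast hn1
      rw [lt_div_iff₀ hn0] at hn
      refine lt_of_le_of_lt ?_ hn
      gcongr; linarith
  · refine ⟨q1 + 1, ?_⟩
    rw [eventually_map]
    simp only [Uset, Set.mem_ofPred_eq, not_exists, not_frequently, not_lt] at h2
    filter_upwards [h2 0, eventually_ge_atTop 1] with n hn hn1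
    have hn0 : (0:ℝ) < n := by exact_mod_cast hn1
    rw [div_le_iff₀ hn0]
    simpa using hn
  · refine ⟨-q2 - 1, ?_⟩
    rw [eventually_map]
    simp only [Dset, Set.mem_ofPred_eq, not_exists, not_frequently, not_lt] at h3
    filter_upwards [h3 0, eventually_ge_atTop 1] with n hn hn1
    have hn0 : (0:ℝ) < n := by exact_mod_cast hn1
    rw [ge_iff_le, le_div_iff₀ hn0]
    simpa using hn

lemma lim_integrable (h : SubProc μ T X) [IsFiniteMeasure μ] {c : ℝ}
    (hc : ∀ n : ℕ, c * n ≤ ∫ ω, X n ω ∂μ) {Y : Ω → ℝ}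
    (hY : ∀ᵐ ω ∂μ, Tendsto (fun n : ℕ => X n ω / n) atTop (nhds (Y ω))) : Integrable Y μ := by
  have hm : ∀ n : ℕ, Integrable (fun ω => X n ω / n) μ := fun n => (h.int n).div_const _
  refine ⟨aestronglyMeasurable_of_tendsto_ae atTop (fun n => (hm n).aestronglyMeasurable) hY, ?_⟩
  set V := ∫ ω, max (X 1 ω) 0 ∂μ with hV
  have hb : ∀ n : ℕ, ∫⁻ ω, ‖X n ω / n‖ₑ ∂μ ≤ ENNReal.ofReal |2 * V - c| := by
    intro n
    rw [← ofReal_integral_norm_eq_lintegral_enorm (hm n)]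
    apply ENNReal.ofReal_le_ofReal
    rcases Nat.eq_zero_or_pos n with rfl | hn
    · simp
    have hn0 : (0:ℝ) < n := by exact_mod_cast hn
    refine le_trans ?_ (le_abs_self _)
    have e : ∀ ω, ‖X n ω / n‖ = (2 * max (X n ω) 0 - X n ω) / n := by
      intro ω
      rw [norm_div, Real.norm_eq_abs, Real.norm_of_nonneg hn0.le]
      congr 1
      rcases le_total 0 (X n ω) with h0 | h0
      · rw [abs_of_nonneg h0, max_eq_left h0]; ring
      · rw [abs_of_nonpos h0, max_eq_right h0]; ring
    simp_rw [e]
    have hp : Integrable (fun ω => 2 * max (X n ω) 0) μ := (h.int n).pos_part.const_mul 2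
    rw [integral_div, integral_sub hp (h.int n), integral_const_mul, div_le_iff₀ hn0]
    have h1 := int_pos_le h n
    have h2 := hc n
    linarith
  calc ∫⁻ ω, ‖Y ω‖ₑ ∂μ = ∫⁻ ω, liminf (fun n : ℕ => ‖X n ω / n‖ₑ) atTop ∂μ :=
        lintegral_congr_ae (by filter_upwards [hY] with ω hω using hω.enorm.liminf_eq.symm)
    _ ≤ liminf (fun n : ℕ => ∫⁻ ω, ‖X n ω / n‖ₑ ∂μ) atTop :=
        lintegral_liminf_le' fun n => (hm n).aestronglyMeasurable.aemeasurable.enorm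
    _ ≤ liminf (fun _ : ℕ => ENNReal.ofReal |2 * V - c|) atTop :=
        liminf_le_liminf (Eventually.of_forall hb)
    _ = ENNReal.ofReal |2 * V - c| := liminf_const _
    _ < ⊤ := ENNReal.ofReal_lt_top

lemma lim_inv (h : SubProc μ T X) [IsFiniteMeasure μ] {Y : Ω → ℝ} (hYi : Integrable Y μ)
    (hY : ∀ᵐ ω ∂μ, Tendsto (fun n : ℕ => X n ω / n) atTop (nhds (Y ω))) :
    ∀ᵐ ω ∂μ, Y (T ω) = Y ω := by
  have hYT : Integrable (fun ω => Y (T ω)) μ := h.mp.integrable_comp_of_integrable hYi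
  have hle : ∀ᵐ ω ∂μ, 0 ≤ Y (T ω) - Y ω := by
    filter_upwards [hY, h.mp.quasiMeasurePreserving.ae hY] with ω h1 h2
    rw [sub_nonneg]
    have h3 := h1.comp (tendsto_add_atTop_nat 1)
    have h4 : Tendsto (fun n : ℕ => X 1 ω / ((n:ℝ) + 1) + X n (T ω) / n * (n / ((n:ℝ) + 1))) atTop
        (nhds (0 + Y (T ω) * 1)) := by
      refine Tendsto.add ?_ (h2.mul (tendsto_natCast_div_add_atTop 1))
      exact tendsto_const_nhds.div_atTop
        (tendsto_atTop_add_const_right _ _ tendsto_natCast_atTop_atTop)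
    rw [zero_add, mul_one] at h4
    refine le_of_tendsto_of_tendsto h3 h4 ?_
    filter_upwards [eventually_ge_atTop 1] with n hn
    have hn0 : (0:ℝ) < n := by exact_mod_cast hn
    have h5 := h.sub 1 n ω
    rw [add_comm 1 n, Function.iterate_one] at h5
    simp only [Function.comp]
    rw [div_mul_div_cancel₀ hn0.ne', ← add_div]
    push_cast
    gcongr
  have hz : ∫ ω, (Y (T ω) - Y ω) ∂μ = 0 := by
    rw [integral_sub hYT hYi, int_comp h.mp hYi, sub_self]
  have := (integral_eq_zero_iff_of_nonneg_ae hle (hYT.sub hYi)).1 hz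
  filter_upwards [this] with ω hω
  simpa [sub_eq_zero] using hω

lemma lim_int [IsProbabilityMeasure μ] (h : SubProc μ T X) {Y : Ω → ℝ} (hYi : Integrable Y μ)
    (hY : ∀ᵐ ω ∂μ, Tendsto (fun n : ℕ => X n ω / n) atTop (nhds (Y ω))) {γ : ℝ}
    (hγ : ∀ n : ℕ, γ * n ≤ ∫ ω, X n ω ∂μ)
    (hlim : Tendsto (fun n : ℕ => (∫ ω, X n ω ∂μ) / n) atTop (nhds γ)) :
    ∫ ω, Y ω ∂μ = γ := by
  have hinv := lim_inv h hYi hY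
  have hsh : ∀ r : ℝ, Integrable (fun ω => Y ω + r) μ := fun r => hYi.add (integrable_const r)
  have hshi : ∀ r : ℝ, ∫ ω, (Y ω + r) ∂μ = ∫ ω, Y ω ∂μ + r := fun r => by
    rw [integral_add hYi (integrable_const r)]; simp
  have hshT : ∀ r : ℝ, ∀ᵐ ω ∂μ, (fun ω => Y ω + r) (T ω) = (fun ω => Y ω + r) ω := fun r => by
    filter_upwards [hinv] with ω hω
    simp [hω]
  apply le_antisymm
  · apply le_of_forall_pos_le_add
    intro ε hε
    refine sub_le_iff_le_add.1 ?_
    refine ge_of_tendsto hlim ?_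
    filter_upwards [eventually_ge_atTop 1] with k hk
    have := U1 h (hsh (-ε)) (hshT (-ε)) (δ := ε / 2) (by positivity) (by
      filter_upwards [hY] with ω hω
      refine Eventually.frequently ?_
      filter_upwards [(tendsto_order.1 hω).1 (Y ω - ε / 2) (by linarith),
        eventually_ge_atTop 1] with n hn hn1
      have hn0 : (0:ℝ) < n := by exact_mod_cast hn1
      rw [lt_div_iff₀ hn0] at hn
      refine le_trans (le_of_eq ?_) hn.le
      ring) hk
    rw [hshi] at this
    rw [le_div_iff₀ (by exact_mod_cast hk)]
    linarith
  · apply le_of_forall_pos_le_add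
    intro ε hε
    obtain ⟨n, hn, h1⟩ := L1lem h (hsh (ε / 2)) (hshT (ε / 2)) (by
      filter_upwards [hY] with ω hω
      obtain ⟨n, hn, hn1⟩ := (((tendsto_order.1 hω).2 (Y ω + ε / 2) (by linarith)).and
        (eventually_ge_atTop 1)).exists
      have hn0 : (0:ℝ) < n := by exact_mod_cast hn1
      rw [div_lt_iff₀ hn0] at hn
      exact ⟨n, hn1, by linarith⟩) (ε := ε / 2) (by positivity)
    rw [hshi] at h1
    have h2 := (hγ n).trans h1
    rw [mul_comm] at h2
    have := le_of_mul_le_mul_left h2 (by exact_mod_cast hn)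
    linarith

lemma exists_lim (h : SubProc μ T X) [IsFiniteMeasure μ] {c : ℝ}
    (hc : ∀ n : ℕ, c * n ≤ ∫ ω, X n ω ∂μ) :
    ∃ Y : Ω → ℝ, Integrable Y μ ∧
      ∀ᵐ ω ∂μ, Tendsto (fun n : ℕ => X n ω / n) atTop (nhds (Y ω)) := by
  classical
  have h1 := ae_conv h hc
  let Y : Ω → ℝ := fun ω =>
    if hω : ∃ y : ℝ, Tendsto (fun n : ℕ => X n ω / n) atTop (nhds y) then hω.choose else 0
  have hY : ∀ᵐ ω ∂μ, Tendsto (fun n : ℕ => X n ω / n) atTop (nhds (Y ω)) := by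
    filter_upwards [h1] with ω hω
    simp only [Y, dif_pos hω]
    exact hω.choose_spec
  exact ⟨Y, lim_integrable h hc hY, hY⟩

lemma birk_L1 [IsFiniteMeasure μ] (hT : MeasurePreserving T μ μ) {g : Ω → ℝ}
    (hg : Integrable g μ) {W : Ω → ℝ} (hWi : Integrable W μ)
    (hW : ∀ᵐ ω ∂μ, Tendsto (fun n : ℕ => birkhoffSum T g n ω / n) atTop (nhds (W ω))) :
    Tendsto (fun n : ℕ => ∫ ω, |birkhoffSum T g n ω / n - W ω| ∂μ) atTop (nhds 0) := by
  have hid : ∀ i : ℕ, ProbabilityTheory.IdentDistrib (fun ω => g (T^[i] ω)) (fun ω => g (T^[0] ω))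
      μ μ := fun i =>
    { aemeasurable_fst := ((hT.iterate i).integrable_comp_of_integrable hg).aemeasurable
      aemeasurable_snd := hg.aemeasurable
      map_eq := by
        have h1 : AEMeasurable g (Measure.map T^[i] μ) := by
          rw [(hT.iterate i).map_eq]; exact hg.aemeasurable
        have := AEMeasurable.map_map_of_aemeasurable h1 (hT.iterate i).aemeasurable
        rw [(hT.iterate i).map_eq] at this
        exact this.symm }
  have hui := ProbabilityTheory.MemLp.uniformIntegrable_of_identDistrib
    (f := fun i ω => g (T^[i] ω)) (j := 0) le_rfl ENNReal.one_ne_top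
    (memLp_one_iff_integrable.2 hg) hid
  have hui2 := uniformIntegrable_average_real le_rfl hui
  have hfe : (fun n : ℕ => (∑ i ∈ Finset.range n, fun ω => g (T^[i] ω)) / (n : Ω → ℝ)) =
      fun n ω => birkhoffSum T g n ω / n := by
    ext n ω; simp [birkhoffSum]
  rw [hfe] at hui2
  have hi : ∀ n : ℕ, Integrable (fun ω => birkhoffSum T g n ω / n) μ :=
    fun n => ((birk_proc hT hg).int n).div_const _
  have hl := tendsto_Lp_finite_of_tendsto_ae le_rfl ENNReal.one_ne_top
    (fun n => (hi n).aestronglyMeasurable) (memLp_one_iff_integrable.2 hWi) hui2.2.1 hW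
  have hl2 := (ENNReal.tendsto_toReal ENNReal.zero_ne_top).comp hl
  rw [ENNReal.toReal_zero] at hl2
  refine hl2.congr fun n => ?_
  simp only [Function.comp]
  rw [eLpNorm_one_eq_lintegral_enorm, ← integral_norm_eq_lintegral_enorm
    ((hi n).sub hWi).aestronglyMeasurable]
  rfl

lemma scheffe {D : ℕ → Ω → ℝ} {D' : Ω → ℝ} (hD : ∀ n, Integrable (D n) μ)
    (hD' : Integrable D' μ) (h0 : ∀ n ω, 0 ≤ D n ω)
    (hlim : ∀ᵐ ω ∂μ, Tendsto (fun n => D n ω) atTop (nhds (D' ω)))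
    (hint : Tendsto (fun n => ∫ ω, D n ω ∂μ) atTop (nhds (∫ ω, D' ω ∂μ))) :
    Tendsto (fun n => ∫ ω, |D n ω - D' ω| ∂μ) atTop (nhds 0) := by
  have hp : ∀ n, Integrable (fun ω => max (D' ω - D n ω) 0) μ := fun n => (hD'.sub (hD n)).pos_part
  have h1 : Tendsto (fun n => ∫ ω, max (D' ω - D n ω) 0 ∂μ) atTop (nhds (∫ _, (0:ℝ) ∂μ)) := by
    refine tendsto_integral_of_dominated_convergence (fun ω => |D' ω|)
      (fun n => (hp n).aestronglyMeasurable) hD'.abs (fun n => Eventually.of_forall fun ω => ?_) ?_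
    · rw [Real.norm_of_nonneg (le_max_right _ _)]
      refine max_le ?_ (abs_nonneg _)
      linarith [h0 n ω, le_abs_self (D' ω)]
    · filter_upwards [hlim] with ω hω
      have := (tendsto_const_nhds (x := D' ω)).sub hω |>.max (tendsto_const_nhds (x := (0:ℝ)))
      simpa using this
  rw [integral_zero] at h1
  have h2 := (hint.sub_const (∫ ω, D' ω ∂μ)).add (h1.const_mul 2)
  rw [sub_self, mul_zero, add_zero] at h2
  refine h2.congr fun n => ?_
  have hs : Integrable (fun ω => D n ω - D' ω) μ := (hD n).sub hD'
  rw [← integral_sub (hD n) hD', ← integral_const_mul, ← integral_add hs ((hp n).const_mul 2)]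
  congr 1
  ext ω
  rcases le_total (D' ω) (D n ω) with h | h
  · rw [max_eq_right (by linarith), abs_of_nonneg (by linarith)]; ring
  · rw [max_eq_left (by linarith), abs_of_nonpos (by linarith)]; ring

lemma main_proc [IsProbabilityMeasure μ] (h : SubProc μ T X) {c : ℝ}
    (hc : ∀ n : ℕ, c * n ≤ ∫ ω, X n ω ∂μ) :
    ∃ (Y : Ω → ℝ) (γ : ℝ), Integrable Y μ ∧
      (∀ᵐ ω ∂μ, Tendsto (fun n : ℕ => X n ω / n) atTop (nhds (Y ω))) ∧
      Tendsto (fun n : ℕ => ∫ ω, |X n ω / n - Y ω| ∂μ) atTop (nhds 0) ∧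
      (∀ᵐ ω ∂μ, Y (T ω) = Y ω) ∧
      Tendsto (fun n : ℕ => (∫ ω, X n ω ∂μ) / n) atTop (nhds γ) ∧
      IsGLB {x : ℝ | ∃ n : ℕ, 1 ≤ n ∧ x = (∫ ω, X n ω ∂μ) / n} γ ∧ ∫ ω, Y ω ∂μ = γ := by
  have hsa : Subadditive (fun n => ∫ ω, X n ω ∂μ) := by
    intro m n
    have hTi : Integrable (fun ω => X n (T^[m] ω)) μ :=
      (h.mp.iterate m).integrable_comp_of_integrable (h.int n)
    calc ∫ ω, X (m + n) ω ∂μ ≤ ∫ ω, (X m ω + X n (T^[m] ω)) ∂μ :=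
          integral_mono (h.int _) ((h.int m).add hTi) (h.sub m n)
      _ = _ := by
        rw [integral_add (h.int m) hTi]
        congr 1
        exact int_comp (h.mp.iterate m) (h.int n)
  have hbd : BddBelow (Set.range fun n : ℕ => (∫ ω, X n ω ∂μ) / n) := by
    refine ⟨min c 0, ?_⟩
    rintro _ ⟨n, rfl⟩
    rcases Nat.eq_zero_or_pos n with rfl | hn
    · simp
    · refine (min_le_left _ _).trans ?_
      rw [le_div_iff₀ (by exact_mod_cast hn)]
      exact hc n
  have hlim := hsa.tendsto_lim hbd
  have hle : ∀ n : ℕ, 1 ≤ n → hsa.lim ≤ (∫ ω, X n ω ∂μ) / n :=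
    fun n hn => hsa.lim_le_div hbd (by omega)
  have hle' : ∀ n : ℕ, hsa.lim * n ≤ ∫ ω, X n ω ∂μ := by
    intro n
    rcases Nat.eq_zero_or_pos n with rfl | hn
    · simp [h.zero]
    · exact (le_div_iff₀ (by exact_mod_cast hn)).1 (hle n hn)
  obtain ⟨Y, hYi, hY⟩ := exists_lim h hc
  have hYint := lim_int h hYi hY hle' hlim
  refine ⟨Y, hsa.lim, hYi, hY, ?_, lim_inv h hYi hY, hlim, ⟨?_, ?_⟩, hYint⟩
  · have hb := birk_proc h.mp (h.int 1)
    have hbi := birk_integral h.mp (h.int 1)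
    have hbc : ∀ n : ℕ, (∫ ω, X 1 ω ∂μ) * n ≤ ∫ ω, birkhoffSum T (X 1) n ω ∂μ :=
      fun n => by rw [hbi, mul_comm]
    obtain ⟨W, hWi, hW⟩ := exists_lim hb hbc
    have hblim : Tendsto (fun n : ℕ => (∫ ω, birkhoffSum T (X 1) n ω ∂μ) / n) atTop
        (nhds (∫ ω, X 1 ω ∂μ)) := by
      refine tendsto_const_nhds.congr' ?_
      filter_upwards [eventually_ge_atTop 1] with n hn
      have hn0 : (0:ℝ) < n := by exact_mod_cast hn
      rw [hbi]; field_simp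
    have hWint := lim_int hb hWi hW hbc hblim
    have hWL := birk_L1 h.mp (h.int 1) hWi hW
    have hA : ∀ n : ℕ, Integrable (fun ω => birkhoffSum T (X 1) n ω / n) μ :=
      fun n => (hb.int n).div_const _
    have hX : ∀ n : ℕ, Integrable (fun ω => X n ω / n) μ := fun n => (h.int n).div_const _
    have hS := scheffe (μ := μ) (D := fun n ω => birkhoffSum T (X 1) n ω / n - X n ω / n)
      (D' := fun ω => W ω - Y ω) (fun n => (hA n).sub (hX n)) (hWi.sub hYi) (fun n ω => by
        have := block h 1 n ω
        rw [one_mul, Function.iterate_one] at this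
        rw [sub_nonneg]; gcongr) (by
        filter_upwards [hY, hW] with ω h1 h2 using h2.sub h1) (by
        rw [integral_sub hWi hYi, hWint, hYint]
        refine (hblim.sub hlim).congr fun n => ?_
        rw [integral_sub (hA n) (hX n), integral_div, integral_div])
    have hsum := hWL.add hS
    rw [add_zero] at hsum
    refine squeeze_zero (fun n => integral_nonneg fun ω => abs_nonneg _) (fun n => ?_) hsum
    have i1 : Integrable (fun ω => |birkhoffSum T (X 1) n ω / n - W ω|) μ := ((hA n).sub hWi).abs
    have i2 : Integrable (fun ω => |birkhoffSum T (X 1) n ω / n - X n ω / n - (W ω - Y ω)|) μ :=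
      (((hA n).sub (hX n)).sub (hWi.sub hYi)).abs
    rw [← integral_add i1 i2]
    refine integral_mono ((hX n).sub hYi).abs (i1.add i2) fun ω => ?_
    have e : X n ω / n - Y ω = (birkhoffSum T (X 1) n ω / n - W ω)
      - (birkhoffSum T (X 1) n ω / n - X n ω / n - (W ω - Y ω)) := by ring
    simp only
    rw [e]
    exact abs_sub _ _
  · rintro _ ⟨n, hn, rfl⟩
    exact hle n hn
  · intro y hy
    refine ge_of_tendsto hlim ?_
    filter_upwards [eventually_ge_atTop 1] with n hn
    exact hy ⟨n, hn, rfl⟩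
end Kingman

/-- (Kingman's subadditive ergodic theorem) If `T` is measure preserving,
`(X_n)_{n≥1}` are integrable, `X_{m+n} ≤ X_m + X_n ∘ T^m`, and
`inf_n E[X_n]/n > -∞`, then `X_n / n` converges almost surely and in `L¹` to a
`T`-invariant random variable `Y`; if moreover `T` is ergodic, the limit is the
constant `γ = lim_n E[X_n]/n = inf_{n≥1} E[X_n]/n`. -/
theorem kingman_subadditive_ergodic
    {Ω : Type*} [MeasurableSpace Ω] (P : Measure Ω) [IsProbabilityMeasure P]
    (T : Ω → Ω) (hT : MeasurePreserving T P P)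
    (X : ℕ → Ω → ℝ)
    (hint : ∀ n, 1 ≤ n → Integrable (X n) P)
    (hsub : ∀ m n, 1 ≤ m → 1 ≤ n → ∀ ω, X (m + n) ω ≤ X m ω + X n (T^[m] ω))
    (hbdd : ∃ c : ℝ, ∀ n, 1 ≤ n → c ≤ (∫ ω, X n ω ∂P) / n) :
    ∃ Y : Ω → ℝ, Integrable Y P ∧
      (∀ᵐ ω ∂P, Tendsto (fun n : ℕ => X n ω / n) atTop (nhds (Y ω))) ∧
      Tendsto (fun n : ℕ => ∫ ω, |X n ω / n - Y ω| ∂P) atTop (nhds 0) ∧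
      (∀ᵐ ω ∂P, Y (T ω) = Y ω) ∧
      (Ergodic T P →
        ∃ γ : ℝ,
          Tendsto (fun n : ℕ => (∫ ω, X n ω ∂P) / n) atTop (nhds γ) ∧
          IsGLB {x : ℝ | ∃ n : ℕ, 1 ≤ n ∧ x = (∫ ω, X n ω ∂P) / n} γ ∧
          ∀ᵐ ω ∂P, Y ω = γ) := by
  obtain ⟨c, hc⟩ := hbdd
  set X' : ℕ → Ω → ℝ := fun n => if n = 0 then fun _ => 0 else X n with hX'
  have e : ∀ n, 1 ≤ n → X' n = X n := fun n hn => by simp [hX', show n ≠ 0 by omega]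
  have e0 : X' 0 = fun _ => 0 := by simp [hX']
  have h : SubProc P T X' := by
    refine ⟨hT, fun n => ?_, fun ω => by rw [e0], fun m n ω => ?_⟩
    · rcases Nat.eq_zero_or_pos n with rfl | hn
      · rw [e0]; exact integrable_zero _ _ _
      · rw [e n hn]; exact hint n hn
    · rcases Nat.eq_zero_or_pos n with rfl | hn
      · simp [e0]
      rcases Nat.eq_zero_or_pos m with rfl | hm
      · simp [e0]
      rw [e n hn, e m hm, e (m + n) (by omega)]
      exact hsub m n hm hn ω
  have hc' : ∀ n : ℕ, c * n ≤ ∫ ω, X' n ω ∂P := by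
    intro n
    rcases Nat.eq_zero_or_pos n with rfl | hn
    · simp [e0]
    · rw [e n hn]
      exact (le_div_iff₀ (by exact_mod_cast hn)).1 (hc n hn)
  obtain ⟨Y, γ, h1, h2, h3, h4, h5, h6, h7⟩ := main_proc h hc'
  have q1 : ∀ (n : ℕ) ω, X' n ω / n = X n ω / n := by
    intro n ω
    rcases Nat.eq_zero_or_pos n with rfl | hn
    · simp
    · rw [e n hn]
  have q2 : ∀ n : ℕ, (∫ ω, X' n ω ∂P) / n = (∫ ω, X n ω ∂P) / n := by
    intro n
    rcases Nat.eq_zero_or_pos n with rfl | hn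
    · simp
    · rw [e n hn]
  simp only [q1, q2] at h2 h3 h5 h6
  refine ⟨Y, h1, h2, h3, h4, fun herg => ⟨γ, h5, h6, ?_⟩⟩
  obtain ⟨k, hk⟩ := herg.ae_eq_const_of_ae_eq_comp_ae h1.aestronglyMeasurable h4
  have hkγ : k = γ := by
    rw [← h7, integral_congr_ae hk]; simp
  filter_upwards [hk] with ω hω
  rw [hω, ← hkγ]; rfl
end
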